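/- arXiv:1406.1130 — 4 statements merged into one kernel-verified Lean document; each statement's English description precedes it below -/
import Mathlib

section
/- Let K be a finite field and c ≥ 1 an integer. There exists a countable c-nilpotent graded Lie algebra M_0 over K such that: (i) every at most countable c-nilpotent graded Lie algebra over K admits an injective graded homomorphism into M_0; and (ii) M_0 is ultrahomogeneous, i.e., every graded isomorphism between finitely generated graded subalgebras of M_0 extends to a graded automorphism of M_0. -/
universe u

/-- A `c`-nilpotent graded Lie algebra over `K`. -/
structure CNilpGradedLieAlg (K : Type u) [Field K] (c : ℕ) where
  carrier : Type u
  [lieRing : LieRing carrier]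
  [lieAlgebra : LieAlgebra K carrier]
  piece : ℕ → Submodule K carrier
  isInternal : DirectSum.IsInternal piece
  piece_zero : piece 0 = ⊥
  piece_of_gt : ∀ n, c < n → piece n = ⊥
  lie_mem : ∀ i j (x y : carrier), x ∈ piece i → y ∈ piece j → ⁅x, y⁆ ∈ piece (i + j)

attribute [instance] CNilpGradedLieAlg.lieRing CNilpGradedLieAlg.lieAlgebra

instance (K : Type u) [Field K] (c : ℕ) : CoeSort (CNilpGradedLieAlg K c) (Type u) :=
  ⟨CNilpGradedLieAlg.carrier⟩

/-- A Lie algebra homomorphism between graded Lie algebras is graded if it maps the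
`i`-th component into the `i`-th component for every `i`. -/
def LieHomIsGraded {K : Type u} [Field K] {c : ℕ} (A B : CNilpGradedLieAlg K c)
    (f : A →ₗ⁅K⁆ B) : Prop :=
  ∀ i (x : A), x ∈ A.piece i → f x ∈ B.piece i

/-- A Lie subalgebra of a graded Lie algebra is graded if it is the (direct) sum of
its intersections with the graded components. -/
def LieSubalgIsGraded {K : Type u} [Field K] {c : ℕ} (A : CNilpGradedLieAlg K c)
    (S : LieSubalgebra K A) : Prop :=
  S.toSubmodule = ⨆ i, S.toSubmodule ⊓ A.piece i

/-- A Lie subalgebra is finitely generated if it is the Lie span of a finite set. -/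
def LieSubalgFG {K : Type u} [Field K] {c : ℕ} (A : CNilpGradedLieAlg K c)
    (S : LieSubalgebra K A) : Prop :=
  ∃ s : Finset A, LieSubalgebra.lieSpan K A (s : Set A) = S

namespace Fr

section Basics

class GrLie (K : Type u) (c : ℕ) (L : Type u) [Field K] [LieRing L] [LieAlgebra K L] where
  pr' : ℕ → L →ₗ[K] L
  pp' : ∀ i j x, pr' i (pr' j x) = if i = j then pr' j x else 0
  sm' : ∀ x, ∑ i ∈ Finset.Icc 1 c, pr' i x = x
  lm' : ∀ i j x y, pr' i x = x → pr' j y = y → pr' (i + j) ⁅x, y⁆ = ⁅x, y⁆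

variable (K : Type u) (c : ℕ) {L : Type u} [Field K] [LieRing L] [LieAlgebra K L] [GrLie K c L]

def pr (i : ℕ) : L →ₗ[K] L := GrLie.pr' (K := K) (c := c) i

theorem pr_pr (i j : ℕ) (x : L) : pr K c i (pr K c j x) = if i = j then pr K c j x else 0 :=
  GrLie.pp' i j x

theorem pr_self (i : ℕ) (x : L) : pr K c i (pr K c i x) = pr K c i x := by
  rw [pr_pr, if_pos rfl]

theorem pr_sum (x : L) : ∑ i ∈ Finset.Icc 1 c, pr K c i x = x := GrLie.sm' x

theorem pr_lie {i j : ℕ} {x y : L} (hx : pr K c i x = x) (hy : pr K c j y = y) :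
    pr K c (i + j) ⁅x, y⁆ = ⁅x, y⁆ := GrLie.lm' i j x y hx hy

theorem pr_hom {k : ℕ} {x : L} (hx : pr K c k x = x) (i : ℕ) :
    pr K c i x = if i = k then x else 0 := by
  rw [← hx, pr_pr, hx]

theorem pr_out {i : ℕ} (hi : i ∉ Finset.Icc 1 c) (x : L) : pr K c i x = 0 := by
  conv_lhs => rw [← pr_sum K c x, map_sum]
  apply Finset.sum_eq_zero
  intro j hj
  rw [pr_pr, if_neg]
  rintro rfl
  exact hi hj

theorem hom_out {i : ℕ} (hi : i ∉ Finset.Icc 1 c) {x : L} (hx : pr K c i x = x) : x = 0 := by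
  rw [← hx, pr_out K c hi]

/-- graded subalgebra, as a submodule -/
structure GS (B : Submodule K L) : Prop where
  lie : ∀ x ∈ B, ∀ y ∈ B, ⁅x, y⁆ ∈ B
  pr : ∀ i, ∀ x ∈ B, pr K c i x ∈ B

variable {K c}

theorem GS.ind {B : Submodule K L} (hB : GS K c B) {P : L → Prop}
    (hadd : ∀ x ∈ B, ∀ y ∈ B, P x → P y → P (x + y)) (h0 : P 0)
    (hom : ∀ k ∈ Finset.Icc 1 c, ∀ x ∈ B, Fr.pr K c k x = x → P x) : ∀ x ∈ B, P x := by
  intro x hx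
  rw [← pr_sum K c x]
  have : ∀ s : Finset ℕ, s ⊆ Finset.Icc 1 c → P (∑ i ∈ s, Fr.pr K c i x) := by
    intro s
    induction s using Finset.induction_on with
    | empty => intro _; simpa using h0
    | insert a s ha ih =>
      intro hs
      rw [Finset.sum_insert ha]
      refine hadd _ (hB.pr _ _ hx) _ (Submodule.sum_mem _ fun i _ => hB.pr _ _ hx) ?_ (ih ?_)
      · exact hom a (hs (Finset.mem_insert_self _ _)) _ (hB.pr _ _ hx) (pr_self K c a x)
      · exact fun i hi => hs (Finset.mem_insert_of_mem hi)
  exact this _ subset_rfl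

theorem GS.top : GS K c (⊤ : Submodule K L) := ⟨by simp, by simp⟩

theorem exists_step {B S : Submodule K L} (hB : GS K c B) (hS : GS K c S) (hlt : B < S) :
    ∃ k ∈ Finset.Icc 1 c, ∃ x ∈ S, Fr.pr K c k x = x ∧ x ∉ B ∧ ∀ b ∈ B, ⁅x, b⁆ ∈ B := by
  classical
  let s := (Finset.Icc 1 c).filter fun k => ∃ x ∈ S, Fr.pr K c k x = x ∧ x ∉ B
  have hne : s.Nonempty := by
    obtain ⟨z, hzS, hzB⟩ := SetLike.exists_of_lt hlt
    by_contra hs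
    apply hzB
    rw [← pr_sum K c z]
    refine Submodule.sum_mem _ fun i hi => ?_
    by_contra hiB
    exact hs ⟨i, Finset.mem_filter.2 ⟨hi, _, hS.pr i z hzS, pr_self K c i z, hiB⟩⟩
  obtain ⟨k, hks, hmax⟩ := s.exists_max_image id hne
  obtain ⟨hk, x, hxS, hx, hxB⟩ := Finset.mem_filter.1 hks
  refine ⟨k, hk, x, hxS, hx, hxB, hB.ind ?_ (by simp) ?_⟩
  · intro a _ b _ ha hb
    rw [lie_add]; exact B.add_mem ha hb
  · intro j hj b hb hjb
    by_contra hn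
    have h1 := pr_lie K c hx hjb
    by_cases hkj : k + j ∈ Finset.Icc 1 c
    · have := hmax (k + j) (Finset.mem_filter.2
        ⟨hkj, _, hS.lie _ hxS _ (hlt.le hb), h1, hn⟩)
      simp at this hj
      omega
    · exact hn (by rw [hom_out K c hkj h1]; exact B.zero_mem)

theorem GS.sup {B : Submodule K L} (hB : GS K c B) {k : ℕ} {x : L} (hx : Fr.pr K c k x = x)
    (hxB : ∀ b ∈ B, ⁅x, b⁆ ∈ B) : GS K c (B ⊔ K ∙ x) := by
  refine ⟨?_, ?_⟩
  · intro a ha b hb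
    obtain ⟨a, ha', r, rfl⟩ : ∃ a' ∈ B, ∃ r : K, a' + r • x = a := by
      simpa [Submodule.mem_sup, Submodule.mem_span_singleton] using ha
    obtain ⟨b, hb', q, rfl⟩ : ∃ a' ∈ B, ∃ r : K, a' + r • x = b := by
      simpa [Submodule.mem_sup, Submodule.mem_span_singleton] using hb
    apply Submodule.mem_sup_left
    simp only [add_lie, lie_add, smul_lie, lie_smul, lie_self, smul_zero, add_zero]
    refine B.add_mem (B.add_mem (hB.lie _ ha' _ hb') (B.smul_mem _ (hxB _ hb'))) (B.smul_mem _ ?_)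
    rw [← lie_skew]; exact B.neg_mem (hxB _ ha')
  · intro i a ha
    obtain ⟨a, ha', r, rfl⟩ : ∃ a' ∈ B, ∃ r : K, a' + r • x = a := by
      simpa [Submodule.mem_sup, Submodule.mem_span_singleton] using ha
    rw [map_add, map_smul, pr_hom K c hx]
    refine Submodule.add_mem _ (Submodule.mem_sup_left (hB.pr _ _ ha')) (Submodule.smul_mem _ _ ?_)
    split_ifs
    · exact Submodule.mem_sup_right (Submodule.mem_span_singleton_self x)
    · exact Submodule.zero_mem _

variable (K) in
def brk : L →ₗ[K] L →ₗ[K] L :=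
  LinearMap.mk₂ K (fun x y => ⁅x, y⁆) add_lie smul_lie lie_add lie_smul

/-- finite sets generate finite dimensional graded subalgebras -/
theorem exists_fin_GS (X : Set L) (hX : X.Finite) :
    ∃ B : Submodule K L, GS K c B ∧ X ⊆ B ∧ FiniteDimensional K B := by
  have key : ∀ n : ℕ, ∃ B : Submodule K L, X ⊆ B ∧ FiniteDimensional K B ∧
      (∀ i, ∀ x ∈ B, Fr.pr K c i x ∈ B) ∧ ∀ i ∈ Finset.Icc 1 c, ∀ j ∈ Finset.Icc 1 c, i + j ≤ n →
        ∀ x ∈ B, ∀ y ∈ B, Fr.pr K c i x = x → Fr.pr K c j y = y → ⁅x, y⁆ ∈ B := by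
    intro n
    induction n with
    | zero =>
      let Y : Set L := ⋃ i ∈ Finset.Icc 1 c, Fr.pr K c i '' X
      have hY : Y.Finite := (Finset.finite_toSet _).biUnion fun i _ => hX.image _
      have hpY : ∀ x ∈ X, ∀ i ∈ Finset.Icc 1 c, Fr.pr K c i x ∈ Submodule.span K Y :=
        fun x hx i hi => Submodule.subset_span (Set.mem_biUnion hi ⟨x, hx, rfl⟩)
      refine ⟨Submodule.span K Y, ?_, FiniteDimensional.span_of_finite K hY, ?_, ?_⟩
      · intro x hx
        rw [← pr_sum K c x]
        exact Submodule.sum_mem _ fun i hi => hpY x hx i hi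
      · intro i x hx
        induction hx using Submodule.span_induction with
        | mem x h =>
          obtain ⟨j, hj, z, hz, rfl⟩ := Set.mem_iUnion₂.1 h
          rw [pr_pr]; split_ifs
          · exact hpY z hz j hj
          · exact Submodule.zero_mem _
        | zero => simp
        | add x y _ _ h1 h2 => rw [map_add]; exact Submodule.add_mem _ h1 h2
        | smul a x _ h1 => rw [map_smul]; exact Submodule.smul_mem _ _ h1
      · intro i hi j hj hij
        simp at hi hj
        omega
    | succ n ih =>
      obtain ⟨B, hXB, hfin, hpr, hl⟩ := ih
      have hfg : B.FG := (Submodule.fg_iff_finiteDimensional B).2 hfin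
      let C0 : Submodule K L := Submodule.map₂ (brk K) B B
      have hC0 : C0.FG := Submodule.FG.map₂ _ hfg hfg
      let C := C0.map (Fr.pr K c (n + 1) : L →ₗ[K] L)
      have hC : C.FG := hC0.map _
      have hCd : ∀ z ∈ C, Fr.pr K c (n + 1) z = z := by
        rintro _ ⟨z, _, rfl⟩
        exact pr_self K c _ _
      have hlow : ∀ i ≤ n, ∀ x ∈ B ⊔ C, Fr.pr K c i x = x → x ∈ B := by
        intro i hi x hx hxi
        obtain ⟨y, hy, z, hz, rfl⟩ := Submodule.mem_sup.1 hx
        rw [← hxi, map_add, pr_hom K c (hCd z hz), if_neg (by omega), add_zero]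
        exact hpr _ _ hy
      refine ⟨B ⊔ C, hXB.trans (SetLike.coe_subset_coe.2 le_sup_left),
        (Submodule.fg_iff_finiteDimensional _).1 (hfg.sup hC), ?_, ?_⟩
      · intro i x hx
        obtain ⟨y, hy, z, hz, rfl⟩ := Submodule.mem_sup.1 hx
        rw [map_add, pr_hom K c (hCd z hz)]
        refine Submodule.add_mem _ (Submodule.mem_sup_left (hpr _ _ hy)) ?_
        split_ifs
        · exact Submodule.mem_sup_right hz
        · exact Submodule.zero_mem _
      · intro i hi j hj hij x hx y hy hxi hyj
        have hi' := Finset.mem_Icc.1 hi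
        have hj' := Finset.mem_Icc.1 hj
        have hxB := hlow i (by omega) x hx hxi
        have hyB := hlow j (by omega) y hy hyj
        by_cases hn : i + j ≤ n
        · exact Submodule.mem_sup_left (hl i hi j hj hn x hxB y hyB hxi hyj)
        · have : i + j = n + 1 := by omega
          have h2 := pr_lie K c hxi hyj
          rw [this] at h2
          refine Submodule.mem_sup_right ⟨⁅x, y⁆, ?_, h2⟩
          exact Submodule.apply_mem_map₂ (brk K) hxB hyB
  obtain ⟨B, hXB, hfin, hpr, hl⟩ := key (2 * c)
  refine ⟨B, ⟨?_, hpr⟩, hXB, hfin⟩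
  intro x hx y hy
  rw [← pr_sum K c x, ← pr_sum K c y, sum_lie_sum]
  refine Submodule.sum_mem _ fun i hi => Submodule.sum_mem _ fun j hj => ?_
  have hi' := Finset.mem_Icc.1 hi
  have hj' := Finset.mem_Icc.1 hj
  exact hl _ hi _ hj (by omega) _ (hpr _ _ hx) _ (hpr _ _ hy) (pr_self K c _ _) (pr_self K c _ _)

end Basics
end Fr

namespace Fr
section Env
variable (K : Type u) (L : Type u) [Field K] [LieRing L] [LieAlgebra K L]

abbrev UE := UniversalEnvelopingAlgebra K L

attribute [local instance 100] LieRing.ofAssociativeRing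

variable {L}
def io : L →ₗ[K] UE K L := (UniversalEnvelopingAlgebra.ι K : L →ₗ⁅K⁆ UE K L).toLinearMap

theorem io_lie (x y : L) : io K ⁅x, y⁆ = io K x * io K y - io K y * io K x := by
  have := (UniversalEnvelopingAlgebra.ι K : L →ₗ⁅K⁆ UE K L).map_lie x y
  rw [LieRing.of_associative_ring_bracket] at this
  exact this

theorem exists_lift {A : Type u} [Ring A] [Algebra K A] (f : L →ₗ[K] A)
    (hf : ∀ x y, f ⁅x, y⁆ = f x * f y - f y * f x) :
    ∃ F : UE K L →ₐ[K] A, ∀ x, F (io K x) = f x := by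
  let f' : L →ₗ⁅K⁆ A :=
    { f with map_lie' := by intro x y; rw [LieRing.of_associative_ring_bracket]; exact hf x y }
  exact ⟨UniversalEnvelopingAlgebra.lift K f', fun x => UniversalEnvelopingAlgebra.lift_ι_apply K f' x⟩

theorem UE_ind (S : Subalgebra K (UE K L)) (hS : ∀ x : L, io K x ∈ S) (u : UE K L) : u ∈ S := by
  obtain ⟨F, hF⟩ := exists_lift K (A := S)
    ((io K : L →ₗ[K] UE K L).codRestrict (Subalgebra.toSubmodule S) hS) (by
      intro x y
      apply Subtype.ext
      exact io_lie K x y)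
  have : S.val.comp F = AlgHom.id K (UE K L) := by
    apply UniversalEnvelopingAlgebra.hom_ext
    ext x
    exact congrArg Subtype.val (hF x)
  have h := congrArg (fun g => g u) this
  simp only [AlgHom.comp_apply, AlgHom.id_apply] at h
  rw [← h]
  exact (F u).2

end Env

section Proj
variable {K : Type u} {L : Type u} [Field K] [LieRing L] [LieAlgebra K L]

def ProjOver (B : Submodule K L) : Prop :=
  ∀ (E : Type u) [AddCommGroup E] [Module K E] (ρ : L →ₗ[K] Module.End K E) (P : Submodule K E)
    (p : E →ₗ[K] UE K L),
    (∀ b ∈ B, ∀ e ∈ P, ρ b e ∈ P) →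
    (∀ b ∈ B, ∀ b' ∈ B, ∀ e ∈ P, ρ ⁅b, b'⁆ e = ρ b (ρ b' e) - ρ b' (ρ b e)) →
    (∀ b ∈ B, ∀ e ∈ P, p (ρ b e) = io K b * p e) →
    (∀ u, ∃ e ∈ P, p e = u) →
    ∃ s : UE K L →ₗ[K] E, (∀ u, p (s u) = u) ∧ (∀ u, s u ∈ P) ∧
      ∀ b ∈ B, ∀ u, s (io K b * u) = ρ b (s u)

theorem projOver_top : ProjOver (⊤ : Submodule K L) := by
  intro E _ _ ρ P p h1 h2 h3 h4
  let f : L →ₗ[K] Module.End K P :=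
    { toFun := fun x => (ρ x).restrict (h1 x trivial)
      map_add' := by intro x y; ext e; simp
      map_smul' := by intro r x; ext e; simp }
  obtain ⟨F, hF⟩ := exists_lift K f (by
    intro x y
    ext e
    simpa [f] using h2 x trivial y trivial e e.2)
  obtain ⟨e, heP, he⟩ := h4 1
  have key : ∀ u, ∀ e : P, p (F u e) = u * p e := by
    intro u
    let S : Subalgebra K (UE K L) :=
      { carrier := {u | ∀ e : P, p (F u e) = u * p e}
        mul_mem' := by
          intro a b ha hb e
          simp only [Set.mem_ofPred_eq] at ha hb
          rw [map_mul, Module.End.mul_apply, ha, hb, mul_assoc]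
        add_mem' := by
          intro a b ha hb e
          simp only [Set.mem_ofPred_eq] at ha hb
          rw [map_add, LinearMap.add_apply, Submodule.coe_add, map_add, ha, hb, add_mul]
        algebraMap_mem' := by
          intro r e
          rw [AlgHom.commutes, Module.algebraMap_end_apply, Submodule.coe_smul, map_smul,
            Algebra.smul_def] }
    refine UE_ind K S ?_ u
    intro x e
    rw [hF]
    exact h3 x trivial e e.2
  refine ⟨P.subtype ∘ₗ (LinearMap.applyₗ (⟨e, heP⟩ : P)) ∘ₗ F.toLinearMap, ?_, ?_, ?_⟩
  · intro u
    have := key u ⟨e, heP⟩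
    simp only [he, mul_one] at this
    simpa using this
  · intro u; simp
  · intro b _ u
    simp [hF, f]

/-- coinduced action -/
def TT {E : Type u} [AddCommGroup E] [Module K E] (ρ : L →ₗ[K] Module.End K E) (x : L) :
    ℕ → L → (ℕ → E) → E
  | 0, b, f => ρ b (f 0)
  | n + 1, b, f => TT ρ x n b (fun k => f (k + 1)) + TT ρ x n ⁅x, b⁆ f

section TT
variable {E : Type u} [AddCommGroup E] [Module K E] (ρ : L →ₗ[K] Module.End K E) (x : L)

theorem TT_add_left (n : ℕ) : ∀ (b b' : L) (f : ℕ → E),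
    TT ρ x n (b + b') f = TT ρ x n b f + TT ρ x n b' f := by
  induction n with
  | zero => intro b b' f; simp [TT]
  | succ n ih => intro b b' f; simp only [TT, lie_add, ih]; abel

theorem TT_smul_left (n : ℕ) : ∀ (r : K) (b : L) (f : ℕ → E),
    TT ρ x n (r • b) f = r • TT ρ x n b f := by
  induction n with
  | zero => intro b b' f; simp [TT]
  | succ n ih => intro b b' f; simp only [TT, lie_smul, ih, smul_add]

theorem TT_add_right (n : ℕ) : ∀ (b : L) (f g : ℕ → E),
    TT ρ x n b (f + g) = TT ρ x n b f + TT ρ x n b g := by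
  induction n with
  | zero => intro b f g; simp [TT]
  | succ n ih =>
    intro b f g
    have := ih b (fun k => f (k + 1)) (fun k => g (k + 1))
    simp only [TT, ih]
    rw [show (fun k => (f + g) (k + 1)) = (fun k => f (k + 1)) + (fun k => g (k + 1)) from rfl, ih]
    abel

theorem TT_smul_right (n : ℕ) : ∀ (r : K) (b : L) (f : ℕ → E),
    TT ρ x n b (r • f) = r • TT ρ x n b f := by
  induction n with
  | zero => intro r b f; simp [TT]
  | succ n ih =>
    intro r b f
    simp only [TT, ih]
    rw [show (fun k => (r • f) (k + 1)) = r • (fun k => f (k + 1)) from rfl, ih, smul_add]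

variable {B : Submodule K L} {P : Submodule K E}

theorem TT_mem (hx : ∀ b ∈ B, ⁅x, b⁆ ∈ B) (h1 : ∀ b ∈ B, ∀ e ∈ P, ρ b e ∈ P) (n : ℕ) :
    ∀ b ∈ B, ∀ f : ℕ → E, (∀ k, f k ∈ P) → TT ρ x n b f ∈ P := by
  induction n with
  | zero => intro b hb f hf; exact h1 b hb _ (hf 0)
  | succ n ih =>
    intro b hb f hf
    exact P.add_mem (ih b hb _ fun k => hf _) (ih _ (hx b hb) f hf)

theorem TT_lie (hx : ∀ b ∈ B, ⁅x, b⁆ ∈ B) (h1 : ∀ b ∈ B, ∀ e ∈ P, ρ b e ∈ P)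
    (h2 : ∀ b ∈ B, ∀ b' ∈ B, ∀ e ∈ P, ρ ⁅b, b'⁆ e = ρ b (ρ b' e) - ρ b' (ρ b e)) (n : ℕ) :
    ∀ b ∈ B, ∀ b' ∈ B, ∀ f : ℕ → E, (∀ k, f k ∈ P) →
      TT ρ x n ⁅b, b'⁆ f = TT ρ x n b (fun k => TT ρ x k b' f)
        - TT ρ x n b' (fun k => TT ρ x k b f) := by
  induction n with
  | zero => intro b hb b' hb' f hf; exact h2 b hb b' hb' _ (hf 0)
  | succ n ih =>
    intro b hb b' hb' f hf
    have e1 : ∀ a c : L, TT ρ x n a (fun k => TT ρ x (k + 1) c f) =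
        TT ρ x n a (fun k => TT ρ x k c (fun k => f (k + 1))) +
        TT ρ x n a (fun k => TT ρ x k ⁅x, c⁆ f) := fun a c => TT_add_right ρ x n a _ _
    have e2 : ∀ a c : L, TT ρ x (n + 1) a (fun k => TT ρ x k c f) =
      TT ρ x n a (fun k => TT ρ x (k + 1) c f) + TT ρ x n ⁅x, a⁆ (fun k => TT ρ x k c f) :=
      fun a c => rfl
    rw [e2, e2, e1, e1]
    rw [show TT ρ x (n + 1) ⁅b, b'⁆ f = TT ρ x n ⁅b, b'⁆ (fun k => f (k + 1)) +
      TT ρ x n ⁅x, ⁅b, b'⁆⁆ f from rfl, leibniz_lie, TT_add_left,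
      ih b hb b' hb' _ (fun k => hf _), ih _ (hx b hb) b' hb' f hf, ih b hb _ (hx b' hb') f hf]
    abel

theorem TT_p (hx : ∀ b ∈ B, ⁅x, b⁆ ∈ B) {p : E →ₗ[K] UE K L}
    (h3 : ∀ b ∈ B, ∀ e ∈ P, p (ρ b e) = io K b * p e) (n : ℕ) :
    ∀ b ∈ B, ∀ f : ℕ → E, (∀ k, f k ∈ P) → (∀ k, p (f k) = io K x ^ k * p (f 0)) →
      p (TT ρ x n b f) = io K x ^ n * (io K b * p (f 0)) := by
  induction n with
  | zero => intro b hb f hf _; simpa [TT] using h3 b hb _ (hf 0)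
  | succ n ih =>
    intro b hb f hf hp
    rw [show TT ρ x (n + 1) b f = TT ρ x n b (fun k => f (k + 1)) +
      TT ρ x n ⁅x, b⁆ f from rfl, map_add, ih b hb _ (fun k => hf _) ?_, ih _ (hx b hb) f hf hp,
      io_lie, hp (0 + 1)]
    · simp only [zero_add, pow_one, pow_succ]
      noncomm_ring
    · intro k
      rw [hp, hp (0 + 1), zero_add, pow_one, pow_succ, mul_assoc]

end TT

theorem projOver_step {B : Submodule K L} (hB : ∀ x ∈ B, ∀ y ∈ B, ⁅x, y⁆ ∈ B) {x : L} (hxB : x ∉ B)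
    (hx : ∀ b ∈ B, ⁅x, b⁆ ∈ B) (h : ProjOver (B ⊔ K ∙ x)) : ProjOver B := by
  intro E _ _ ρ P p h1 h2 h3 h4
  obtain ⟨φ, hφx, hφB⟩ : ∃ φ : L →ₗ[K] K, φ x = 1 ∧ ∀ b ∈ B, φ b = 0 := by
    obtain ⟨φ, hφ, hB⟩ := Submodule.exists_le_ker_of_notMem hxB
    refine ⟨(φ x)⁻¹ • φ, by simp [hφ], ?_⟩
    intro b hb
    have : φ b = 0 := hB hb
    simp [this]
  let ρ' : L →ₗ[K] Module.End K (ℕ → E) :=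
    { toFun := fun a =>
        { toFun := fun f n => φ a • f (n + 1) + TT ρ x n (a - φ a • x) f
          map_add' := by
            intro f g; funext n
            simp only [Pi.add_apply, TT_add_right, smul_add]; abel
          map_smul' := by
            intro r f; funext n
            simp only [Pi.smul_apply, TT_smul_right, smul_add, RingHom.id_apply, smul_comm r] }
      map_add' := by
        intro a b; ext f n
        have : a + b - φ (a + b) • x = (a - φ a • x) + (b - φ b • x) := by
          rw [map_add, add_smul]; abel
        simp only [LinearMap.coe_mk, AddHom.coe_mk, LinearMap.add_apply, Pi.add_apply]
        rw [this, TT_add_left, map_add, add_smul]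
        abel
      map_smul' := by
        intro r a; ext f n
        have : r • a - φ (r • a) • x = r • (a - φ a • x) := by
          rw [map_smul, smul_sub, smul_assoc]
        simp only [LinearMap.coe_mk, AddHom.coe_mk, LinearMap.smul_apply, Pi.smul_apply]
        rw [this, TT_smul_left, map_smul, smul_add, RingHom.id_apply, smul_assoc] }
  have hρb : ∀ b ∈ B, ∀ f n, ρ' b f n = TT ρ x n b f := by
    intro b hb f n
    simp [ρ', hφB b hb]
  have hρx : ∀ f n, ρ' x f n = f (n + 1) := by
    intro f n
    have : TT ρ x n 0 f = 0 := by simpa using TT_smul_left ρ x n (0 : K) 0 f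
    simp [ρ', hφx, this]
  let P' : Submodule K (ℕ → E) :=
    { carrier := {f | (∀ k, f k ∈ P) ∧ ∀ k, p (f k) = io K x ^ k * p (f 0)}
      add_mem' := by
        rintro f g ⟨hf, hf'⟩ ⟨hg, hg'⟩
        refine ⟨fun k => P.add_mem (hf k) (hg k), fun k => ?_⟩
        rw [Pi.add_apply, map_add, hf', hg', Pi.add_apply, map_add, mul_add]
      zero_mem' := ⟨fun k => P.zero_mem, fun k => by simp⟩
      smul_mem' := by
        rintro r f ⟨hf, hf'⟩
        refine ⟨fun k => P.smul_mem _ (hf k), fun k => ?_⟩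
        rw [Pi.smul_apply, map_smul, hf', Pi.smul_apply, map_smul, mul_smul_comm] }
  have split : ∀ a ∈ B ⊔ K ∙ x, ∃ b ∈ B, ∃ r : K, b + r • x = a := by
    intro a ha
    simpa [Submodule.mem_sup, Submodule.mem_span_singleton] using ha
  have m1 : ∀ b ∈ B, ∀ f ∈ P', ρ' b f ∈ P' := by
    rintro b hb f ⟨hf, hf'⟩
    refine ⟨fun k => ?_, fun k => ?_⟩
    · rw [hρb b hb]; exact TT_mem ρ x hx h1 k b hb f hf
    · rw [hρb b hb, hρb b hb, TT_p ρ x hx h3 k b hb f hf hf', TT_p ρ x hx h3 0 b hb f hf hf']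
      simp
  have m2 : ∀ f ∈ P', ρ' x f ∈ P' := by
    rintro f ⟨hf, hf'⟩
    refine ⟨fun k => ?_, fun k => ?_⟩
    · rw [hρx]; exact hf _
    · rw [hρx, hρx, hf', hf' (0 + 1), zero_add, pow_one, pow_succ, mul_assoc]
  have c1 : ∀ b ∈ B, ∀ b' ∈ B, ∀ f ∈ P', ρ' ⁅b, b'⁆ f = ρ' b (ρ' b' f) - ρ' b' (ρ' b f) := by
    rintro b hb b' hb' f ⟨hf, hf'⟩
    funext n
    rw [Pi.sub_apply, hρb _ (hB _ hb _ hb'), hρb b hb, hρb b' hb',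
      TT_lie ρ x hx h1 h2 n b hb b' hb' f hf]
    congr 2
    · funext k; rw [hρb b' hb']
    · funext k; rw [hρb b hb]
  have c2 : ∀ b ∈ B, ∀ f, ρ' ⁅x, b⁆ f = ρ' x (ρ' b f) - ρ' b (ρ' x f) := by
    intro b hb f
    funext n
    rw [Pi.sub_apply, hρb _ (hx _ hb), hρx, hρb b hb, hρb b hb]
    have : (ρ' x) f = fun k => f (k + 1) := by funext k; rw [hρx]
    rw [this]
    exact (eq_sub_of_add_eq' rfl)
  have H := h (ℕ → E) ρ' P' (p ∘ₗ LinearMap.proj 0)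
  replace H := H (by
    intro a ha f hf
    obtain ⟨b, hb, r, rfl⟩ := split a ha
    rw [map_add, map_smul]
    exact P'.add_mem (m1 b hb f hf) (P'.smul_mem _ (m2 f hf)))
  replace H := H (by
    intro a ha a' ha' f hf
    obtain ⟨b, hb, r, rfl⟩ := split a ha
    obtain ⟨b', hb', r', rfl⟩ := split a' ha'
    have e : ⁅b + r • x, b' + r' • x⁆ = ⁅b, b'⁆ + r • ⁅x, b'⁆ - r' • ⁅x, b⁆ := by
      simp only [add_lie, lie_add, smul_lie, lie_smul, lie_self, smul_zero, add_zero]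
      rw [← lie_skew x b, smul_neg]; abel
    rw [e]
    simp only [map_add, map_sub, map_smul, LinearMap.add_apply, LinearMap.sub_apply,
      LinearMap.smul_apply, c1 b hb b' hb' f hf, c2 b hb, c2 b' hb', smul_sub, smul_add]
    rw [smul_comm r r']
    abel)
  replace H := H (by
    intro a ha f hf
    obtain ⟨b, hb, r, rfl⟩ := split a ha
    simp only [map_add, map_smul, LinearMap.add_apply, LinearMap.smul_apply, LinearMap.comp_apply,
      LinearMap.proj_apply, hρb b hb, hρx]
    rw [hf.2 (0 + 1), zero_add, pow_one, show TT ρ x 0 b f = ρ b (f 0) from rfl,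
      h3 b hb _ (hf.1 0), add_mul, smul_mul_assoc])
  replace H := H (by
    intro u
    choose e he he' using fun n : ℕ => h4 (io K x ^ n * u)
    refine ⟨e, ⟨he, fun k => ?_⟩, ?_⟩
    · rw [he', he']; simp
    · simp [he'])
  obtain ⟨s, hs1, hs2, hs3⟩ := H
  refine ⟨LinearMap.proj 0 ∘ₗ s, fun u => by simpa using hs1 u, fun u => (hs2 u).1 0, ?_⟩
  intro b hb u
  simp only [LinearMap.comp_apply, hs3 b (Submodule.mem_sup_left hb), LinearMap.proj_apply,
    hρb b hb]
  rfl

theorem exists_der {B : Submodule K L} (hB : ∀ x ∈ B, ∀ y ∈ B, ⁅x, y⁆ ∈ B)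
    (h : ProjOver B) (δ : L →ₗ[K] L)
    (hδ : ∀ a ∈ B, ∀ b ∈ B, δ ⁅a, b⁆ = ⁅δ a, b⁆ + ⁅a, δ b⁆) :
    ∃ X : Module.End K (UE K L), ∀ b ∈ B, ∀ u, X (io K b * u) = io K b * X u + io K (δ b) * u := by
  let ρ : L →ₗ[K] Module.End K (UE K L × UE K L) :=
    { toFun := fun a =>
        { toFun := fun w => (io K a * w.1 + io K (δ a) * w.2, io K a * w.2)
          map_add' := by
            intro v w; ext
            · simp only [Prod.fst_add, Prod.snd_add, mul_add]; abel
            · simp only [Prod.snd_add, mul_add]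
          map_smul' := by intro r v; ext <;> simp }
      map_add' := by
        intro a b; refine LinearMap.ext fun w => ?_; ext
        · simp [add_mul]; abel
        · simp [add_mul]
      map_smul' := by intro r a; refine LinearMap.ext fun w => ?_; ext <;> simp }
  have hρ : ∀ a w, ρ a w = (io K a * w.1 + io K (δ a) * w.2, io K a * w.2) := fun a w => rfl
  obtain ⟨s, hs1, -, hs3⟩ := h (UE K L × UE K L) ρ ⊤ (LinearMap.snd K _ _) (by simp) (by
      intro b hb b' hb' w _
      simp only [hρ, io_lie, hδ b hb b' hb', map_add]
      ext
      · simp only [Prod.fst_sub]; noncomm_ring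
      · simp only [Prod.snd_sub]; noncomm_ring) (by simp [hρ]) (fun u => ⟨(0, u), trivial, rfl⟩)
  refine ⟨LinearMap.fst K _ _ ∘ₗ s, fun b hb u => ?_⟩
  have := hs1 u
  simp only [LinearMap.snd_apply] at this
  simp [hs3 b hb, hρ, this]

theorem projOver_GS {c : ℕ} [GrLie K c L] [FiniteDimensional K L] (n : ℕ) :
    ∀ {B : Submodule K L} (_ : GS K c B) (_ : Module.finrank K L ≤ n + Module.finrank K B),
      ProjOver B := by
  induction n with
  | zero =>
    intro B hB hn
    have : B = ⊤ := Submodule.eq_top_of_finrank_eq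
      (le_antisymm (Submodule.finrank_le B) (by simpa using hn))
    rw [this]; exact projOver_top
  | succ n ih =>
    intro B hB hn
    by_cases hT : B = ⊤
    · rw [hT]; exact projOver_top
    obtain ⟨k, hk, x, -, hx, hxB, hl⟩ := exists_step hB GS.top (lt_top_iff_ne_top.2 hT)
    refine projOver_step hB.lie hxB hl (ih (hB.sup hx hl) ?_)
    have hlt : B < B ⊔ K ∙ x := by
      refine lt_of_le_of_ne le_sup_left fun he => hxB ?_
      rw [he]; exact Submodule.mem_sup_right (Submodule.mem_span_singleton_self x)
    have := Submodule.finrank_lt_finrank_of_lt hlt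
    omega

end Proj
end Fr

namespace Fr
section Sub
variable {K : Type u} {c : ℕ} {L : Type u} [Field K] [LieRing L] [LieAlgebra K L] [GrLie K c L]

@[reducible] def subGr (S : LieSubalgebra K L) (hS : ∀ i, ∀ x ∈ S, pr K c i x ∈ S) : GrLie K c S where
  pr' i := (pr K c i : L →ₗ[K] L).restrict (p := S.toSubmodule) (q := S.toSubmodule) (hS i)
  pp' i j x := by
    apply Subtype.ext
    have := pr_pr K c i j (x : L)
    split_ifs with h
    · rw [if_pos h] at this; exact this
    · rw [if_neg h] at this; exact this
  sm' x := by
    apply Subtype.ext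
    have h := pr_sum K c (x : L)
    have h2 : ((∑ i ∈ Finset.Icc 1 c, (pr K c i : L →ₗ[K] L).restrict (p := S.toSubmodule)
      (q := S.toSubmodule) (hS i) x : S.toSubmodule) : L) =
      ∑ i ∈ Finset.Icc 1 c, pr K c i (x : L) := by
      rw [AddSubmonoidClass.coe_finset_sum]; rfl
    exact h2.trans h
  lm' i j x y hx hy := by
    apply Subtype.ext
    exact pr_lie K c (x := (x : L)) (y := (y : L)) (congrArg Subtype.val hx) (congrArg Subtype.val hy)

/-- the Lie subalgebra attached to a graded submodule -/
def GS.toSub {B : Submodule K L} (h : GS K c B) : LieSubalgebra K L :=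
  { B with lie_mem' := fun {x y} hx hy => h.lie x hx y hy }

end Sub

section Tri
attribute [local instance 100] LieRing.ofAssociativeRing
variable (K : Type u) (c : ℕ) (R : Type u) [Field K] [Ring R] [Algebra K R]

abbrev MM := Matrix (Fin (c + 1)) (Fin (c + 1)) R

def Tri : LieSubalgebra K (MM c R) where
  carrier := {m | ∀ p q, q ≤ p → m p q = 0}
  add_mem' := by
    intro a b ha hb p q h
    rw [Matrix.add_apply, ha p q h, hb p q h, add_zero]
  zero_mem' := by intro p q _; rfl
  smul_mem' := by
    intro r a ha p q h
    rw [Matrix.smul_apply, ha p q h, smul_zero]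
  lie_mem' := by
    intro a b ha hb p q h
    have key : ∀ a b : MM c R, (∀ p q, q ≤ p → a p q = 0) → (∀ p q, q ≤ p → b p q = 0) →
        (a * b) p q = 0 := by
      intro a b ha hb
      rw [Matrix.mul_apply]
      apply Finset.sum_eq_zero
      intro r _
      by_cases hr : r ≤ p
      · rw [ha p r hr, zero_mul]
      · rw [hb r q (h.trans (not_le.1 hr).le), mul_zero]
    rw [LieRing.of_associative_ring_bracket, Matrix.sub_apply, key a b ha hb, key b a hb ha, sub_zero]

def dg (i : ℕ) : MM c R →ₗ[K] MM c R where
  toFun m := Matrix.of fun p q => if (q : ℕ) = p + i then m p q else 0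
  map_add' := by intro a b; ext p q; simp only [Matrix.of_apply, Matrix.add_apply]; split_ifs <;> simp
  map_smul' := by
    intro r b; ext p q; simp only [Matrix.of_apply, Matrix.smul_apply, RingHom.id_apply]
    split_ifs <;> simp

theorem dg_apply (i : ℕ) (m : MM c R) (p q) :
    dg K c R i m p q = if (q : ℕ) = p + i then m p q else 0 := rfl

theorem dg_mul {i j : ℕ} {x y : MM c R} (hx : dg K c R i x = x) (hy : dg K c R j y = y) :
    dg K c R (i + j) (x * y) = x * y := by
  ext p q
  rw [dg_apply]
  split_ifs with h
  · rfl
  · rw [Matrix.mul_apply]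
    symm
    apply Finset.sum_eq_zero
    intro r _
    rw [← hx, ← hy, dg_apply, dg_apply]
    split_ifs with h1 h2
    · exact absurd (by omega) h
    all_goals simp

instance : GrLie K c (Tri K c R) where
  pr' i := (dg K c R i).restrict (p := (Tri K c R).toSubmodule) (q := (Tri K c R).toSubmodule) (by
    intro m hm p q h
    rw [dg_apply, hm p q h, ite_self])
  pp' i j x := by
    have : dg K c R i (dg K c R j x) = if i = j then dg K c R j (x : MM c R) else 0 := by
      ext p q
      rw [dg_apply, dg_apply]
      split_ifs with h1 h2 h3 h3 h3
      · rw [dg_apply, if_pos h2]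
      · omega
      · omega
      · rfl
      · rw [dg_apply, if_neg (by omega)]
      · rfl
    apply Subtype.ext
    split_ifs with h
    · rw [if_pos h] at this; exact this
    · rw [if_neg h] at this; exact this
  sm' x := by
    apply Subtype.ext
    refine (AddSubmonoidClass.coe_finset_sum (S := (Tri K c R).toSubmodule) _ _).trans ?_
    change ∑ i ∈ Finset.Icc 1 c, dg K c R i (x : MM c R) = x
    ext p q
    rw [Matrix.sum_apply]
    simp only [dg_apply]
    by_cases h : q ≤ p
    · have := x.2 p q h
      simp [this]
    · have hlt : (p : ℕ) < q := by simpa using h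
      rw [Finset.sum_eq_single ((q : ℕ) - p)]
      · rw [if_pos (by omega)]
      · intro b _ hb; rw [if_neg (by omega)]
      · intro hn; exfalso; apply hn; rw [Finset.mem_Icc]; omega
  lm' i j x y hx hy := by
    have hx' : dg K c R i x = x := congrArg Subtype.val hx
    have hy' : dg K c R j y = y := congrArg Subtype.val hy
    apply Subtype.ext
    change dg K c R (i + j) ((x : MM c R) * y - y * x) = (x : MM c R) * y - y * x
    have h2 := dg_mul K c R hy' hx'
    rw [add_comm j i] at h2
    rw [map_sub, dg_mul K c R hx' hy', h2]

theorem pr_coe (i : ℕ) (x : Tri K c R) : ((pr K c i x : Tri K c R) : MM c R) = dg K c R i x := rfl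

theorem tri_lie (x y : Tri K c R) : ((⁅x, y⁆ : Tri K c R) : MM c R) = (x : MM c R) * y - y * x := rfl

def Em (i : ℕ) : R →ₗ[K] MM c R where
  toFun m := Matrix.of fun p q => if (q : ℕ) = p + i then m else 0
  map_add' := by intro a b; ext p q; simp only [Matrix.of_apply, Matrix.add_apply]; split_ifs <;> simp
  map_smul' := by
    intro r b; ext p q; simp only [Matrix.of_apply, Matrix.smul_apply, RingHom.id_apply]
    split_ifs <;> simp

theorem Em_apply (i : ℕ) (m : R) (p q) :
    Em K c R i m p q = if (q : ℕ) = p + i then m else 0 := rfl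

theorem Em_mul (i j : ℕ) (x y : R) : Em K c R i x * Em K c R j y = Em K c R (i + j) (x * y) := by
  ext p q
  rw [Matrix.mul_apply, Em_apply]
  simp only [Em_apply]
  split_ifs with h
  · have hr : (p : ℕ) + i < c + 1 := by omega
    rw [Finset.sum_eq_single (⟨p + i, hr⟩ : Fin (c + 1))]
    · rw [if_pos rfl, if_pos (by simp; omega)]
    · intro r _ hne
      rw [if_neg, zero_mul]
      intro h2; exact hne (Fin.ext h2)
    · simp
  · apply Finset.sum_eq_zero
    intro r _
    split_ifs with h1 h2
    · omega
    all_goals simp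

theorem Em_mem {i : ℕ} (hi : 1 ≤ i) (x : R) : Em K c R i x ∈ Tri K c R := by
  intro p q h
  rw [Em_apply, if_neg]
  have : (q : ℕ) ≤ p := h
  omega

theorem dg_Em (i j : ℕ) (x : R) : dg K c R i (Em K c R j x) = if i = j then Em K c R j x else 0 := by
  ext p q
  rw [dg_apply, Em_apply]
  split_ifs with h1 h2 h3 h3
  · rw [Em_apply, if_pos (by omega)]
  · omega
  · omega
  · rfl
  · rw [Em_apply, if_neg (by omega)]
  · rfl

theorem Em_inj {i : ℕ} (hi : i ≤ c) {x y : R} (h : Em K c R i x = Em K c R i y) : x = y := by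
  have := congrFun (congrFun h 0) ⟨i, by omega⟩
  simpa [Em_apply] using this

variable {R}
variable {L : Type u} [LieRing L] [LieAlgebra K L] [GrLie K c L] (ψ : L →ₗ[K] R)

def FF : L →ₗ[K] MM c R := ∑ i ∈ Finset.Icc 1 c, Em K c R i ∘ₗ ψ ∘ₗ pr K c i

theorem FF_apply (a : L) : FF K c ψ a = ∑ i ∈ Finset.Icc 1 c, Em K c R i (ψ (pr K c i a)) := by
  simp [FF, LinearMap.sum_apply]

theorem FF_mem (a : L) : FF K c ψ a ∈ Tri K c R := by
  rw [FF_apply]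
  exact Submodule.sum_mem (Tri K c R).toSubmodule
    fun i hi => Em_mem K c R (Finset.mem_Icc.1 hi).1 _

theorem FF_hom {i : ℕ} {a : L} (ha : pr K c i a = a) : FF K c ψ a = Em K c R i (ψ a) := by
  by_cases hi : i ∈ Finset.Icc 1 c
  · rw [FF_apply, Finset.sum_eq_single i]
    · rw [ha]
    · intro j _ hj
      rw [pr_hom K c ha, if_neg hj]; simp
    · intro h; exact absurd hi h
  · rw [hom_out K c hi ha]; simp

theorem dg_FF (i : ℕ) (a : L) : dg K c R i (FF K c ψ a) = FF K c ψ (pr K c i a) := by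
  rw [FF_apply, map_sum, FF_hom K c ψ (pr_self K c i a)]
  simp only [dg_Em]
  by_cases hi : i ∈ Finset.Icc 1 c
  · rw [Finset.sum_ite_eq, if_pos hi]
  · rw [Finset.sum_ite_eq, if_neg hi, pr_out K c hi]; simp

theorem FF_inj (hψ : Function.Injective ψ) : Function.Injective (FF K c ψ) := by
  intro a b hab
  rw [← pr_sum K c a, ← pr_sum K c b]
  refine Finset.sum_congr rfl fun i hi => hψ ?_
  apply Em_inj K c R (Finset.mem_Icc.1 hi).2
  rw [← FF_hom K c ψ (pr_self K c i a), ← FF_hom K c ψ (pr_self K c i b), ← dg_FF, ← dg_FF, hab]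

theorem FF_lie (hψ : ∀ a b, ψ ⁅a, b⁆ = ψ a * ψ b - ψ b * ψ a) (a b : L) :
    FF K c ψ ⁅a, b⁆ = FF K c ψ a * FF K c ψ b - FF K c ψ b * FF K c ψ a := by
  revert b
  suffices h : ∀ a ∈ (⊤ : Submodule K L), ∀ b ∈ (⊤ : Submodule K L),
      FF K c ψ ⁅a, b⁆ = FF K c ψ a * FF K c ψ b - FF K c ψ b * FF K c ψ a from
    fun b => h a trivial b trivial
  refine (GS.top (c := c)).ind ?_ (by simp) ?_
  · intro x _ y _ hx hy b hb
    rw [add_lie, map_add, hx b hb, hy b hb, map_add, add_mul, mul_add]; abel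
  intro i _ x _ hx
  refine (GS.top (c := c)).ind ?_ (by simp) ?_
  · intro y _ z _ hy hz
    rw [lie_add, map_add, hy, hz, map_add, add_mul, mul_add]; abel
  intro j _ y _ hy
  rw [FF_hom K c ψ hx, FF_hom K c ψ hy, FF_hom K c ψ (pr_lie K c hx hy), Em_mul, Em_mul, hψ,
    map_sub, add_comm j i]

def FL (hψ : ∀ a b, ψ ⁅a, b⁆ = ψ a * ψ b - ψ b * ψ a) : L →ₗ⁅K⁆ Tri K c R :=
  { (FF K c ψ).codRestrict (Tri K c R).toSubmodule (FF_mem K c ψ) with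
    map_lie' := by
      intro x y
      apply Subtype.ext
      exact FF_lie K c ψ hψ x y }

theorem FL_coe (hψ : ∀ a b, ψ ⁅a, b⁆ = ψ a * ψ b - ψ b * ψ a) (a : L) :
  (FL K c ψ hψ a : MM c R) = FF K c ψ a := rfl

end Tri

/-- one-step extension problems over graded subalgebras of `A` are solved in `B` -/
structure Task (K : Type u) (c : ℕ) {L : Type u} [Field K] [LieRing L] [LieAlgebra K L] [GrLie K c L]
    (T : Submodule K L) (k : ℕ) (δ : L →ₗ[K] L) : Prop where
  gs : GS K c T
  hk : k ∈ Finset.Icc 1 c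
  mem : ∀ t ∈ T, δ t ∈ T
  der : ∀ a ∈ T, ∀ b ∈ T, δ ⁅a, b⁆ = ⁅δ a, b⁆ + ⁅a, δ b⁆
  deg : ∀ i, ∀ t ∈ T, pr K c i t = t → pr K c (k + i) (δ t) = δ t

section Step
variable {K : Type u} {c : ℕ} {L : Type u} [Field K] [LieRing L] [LieAlgebra K L] [GrLie K c L]

variable (K L) in
def psi : L →ₗ[K] Module.End K (UE K L × K) where
  toFun a := LinearMap.prodMap (LinearMap.mulLeft K (io K a)) 0
  map_add' a b := by ext <;> simp [add_mul]
  map_smul' r b := by ext <;> simp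

theorem psi_apply (a : L) (w) : psi K L a w = (io K a * w.1, 0) := rfl

theorem psi_lie (a b : L) : psi K L ⁅a, b⁆ = psi K L a * psi K L b - psi K L b * psi K L a := by
  refine LinearMap.ext fun w => ?_
  simp only [LinearMap.sub_apply, Module.End.mul_apply, psi_apply, io_lie]
  ext <;> simp [sub_mul, mul_assoc]

theorem psi_inj (h : Function.Injective (io K : L → UE K L)) : Function.Injective (psi K L) := by
  intro a b hab
  apply h
  have := congrArg Prod.fst (LinearMap.congr_fun hab (1, 0))
  simpa [psi_apply] using this

abbrev BigT (K : Type u) (c : ℕ) (L : Type u) [Field K] [LieRing L] [LieAlgebra K L] :=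
  Tri K c (Module.End K (UE K L × K))

theorem task_sol [FiniteDimensional K L] {T : Submodule K L} {k : ℕ} {δ : L →ₗ[K] L}
    (h : Task K c T k δ) : ∃ y : BigT K c L, pr K c k y = y ∧
      (∀ t, y ≠ FL K c (psi K L) psi_lie t) ∧
      ∀ t ∈ T, ⁅y, FL K c (psi K L) psi_lie t⁆ = FL K c (psi K L) psi_lie (δ t) := by
  obtain ⟨X, hX⟩ := exists_der h.gs.lie (projOver_GS (c := c) (Module.finrank K L) h.gs (by omega)) δ h.der
  have hk := Finset.mem_Icc.1 h.hk
  let x' : Module.End K (UE K L × K) := LinearMap.prodMap X LinearMap.id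
  have hx' : ∀ w, x' w = (X w.1, w.2) := fun w => rfl
  have hcomm : ∀ t ∈ T, x' * psi K L t - psi K L t * x' = psi K L (δ t) := by
    intro t ht
    refine LinearMap.ext fun w => ?_
    simp only [LinearMap.sub_apply, Module.End.mul_apply, psi_apply, hx', hX t ht]
    ext <;> simp
  refine ⟨⟨Em K c _ k x', Em_mem K c _ hk.1 _⟩, ?_, ?_, ?_⟩
  · apply Subtype.ext
    rw [pr_coe, dg_Em, if_pos rfl]
  · intro t ht
    have h1 := congrArg (fun z : BigT K c L => dg K c (Module.End K (UE K L × K)) k z.1) ht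
    simp only [FL_coe, dg_FF, dg_Em, if_true] at h1
    rw [FF_hom K c _ (pr_self K c k t)] at h1
    have h2 := Em_inj K c _ hk.2 h1
    have := congrArg Prod.snd (LinearMap.congr_fun h2 (0, 1))
    simp [psi_apply, hx'] at this
  · refine h.gs.ind ?_ (by simp) ?_
    · intro x _ y _ hx hy
      rw [map_add, lie_add, hx, hy, map_add, map_add]
    · intro j _ t ht hjt
      apply Subtype.ext
      rw [tri_lie, FL_coe, FL_coe, FF_hom K c _ hjt, FF_hom K c _ (h.deg j t ht hjt)]
      rw [Em_mul, Em_mul, add_comm j k, ← map_sub, hcomm t ht]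

end Step

structure FA (K : Type u) (c : ℕ) [Field K] where
  carrier : Type u
  [lieRing : LieRing carrier]
  [lieAlgebra : LieAlgebra K carrier]
  [gr : GrLie K c carrier]
  [fin : Finite carrier]
  inj : Function.Injective (io K : carrier → UE K carrier)

attribute [instance] FA.lieRing FA.lieAlgebra FA.gr FA.fin

structure IsExt {K : Type u} {c : ℕ} [Field K] (A B : FA K c) (f : A.carrier →ₗ⁅K⁆ B.carrier) : Prop where
  inj : Function.Injective f
  pr : ∀ i x, f (Fr.pr K c i x) = Fr.pr K c i (f x)
  sol : ∀ T k δ, Task K c (L := A.carrier) T k δ → ∃ y, Fr.pr K c k y = y ∧ (∀ t ∈ T, y ≠ f t) ∧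
    ∀ t ∈ T, ⁅y, f t⁆ = f (δ t)

section
attribute [local instance 100] LieRing.ofAssociativeRing

theorem io_inj_of {K : Type u} {L A : Type u} [Field K] [LieRing L] [LieAlgebra K L] [Ring A] [Algebra K A]
    (f : L →ₗ[K] A) (hf : ∀ x y, f ⁅x, y⁆ = f x * f y - f y * f x) (hi : Function.Injective f) :
    Function.Injective (io K : L → UE K L) := by
  obtain ⟨F, hF⟩ := exists_lift K f hf
  intro x y h
  apply hi
  rw [← hF, ← hF, h]

theorem exists_ext {K : Type u} {c : ℕ} [Field K] [Finite K] (A : FA K c) :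
    ∃ (B : FA K c) (f : A.carrier →ₗ⁅K⁆ B.carrier), IsExt A B f := by
  classical
  let L := A.carrier
  let F : L →ₗ⁅K⁆ BigT K c L := FL K c (psi K L) psi_lie
  have hFinj : Function.Injective F := fun a b h =>
    FF_inj K c (psi K L) (psi_inj A.inj) (congrArg Subtype.val h)
  have hFpr : ∀ i x, F (pr K c i x) = pr K c i (F x) := fun i x =>
    Subtype.ext (dg_FF K c (psi K L) i x).symm
  have hs : ∀ t : Submodule K L × Fin (c + 1) × (L →ₗ[K] L), ∃ y : BigT K c L,
      Task K c t.1 t.2.1 t.2.2 → pr K c t.2.1 y = y ∧ (∀ z, y ≠ F z) ∧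
        ∀ z ∈ t.1, ⁅y, F z⁆ = F (t.2.2 z) := by
    intro t
    by_cases h : Task K c t.1 t.2.1 t.2.2
    · obtain ⟨y, hy⟩ := task_sol h
      exact ⟨y, fun _ => hy⟩
    · exact ⟨0, fun h' => absurd h' h⟩
  choose y hy using hs
  have : Finite (Submodule K L) := Finite.of_injective _ (SetLike.coe_injective (A := Submodule K L))
  have : Finite (L →ₗ[K] L) := Finite.of_injective _ (DFunLike.coe_injective (F := L →ₗ[K] L))
  obtain ⟨B, hB, hX, hfin⟩ := exists_fin_GS (K := K) (c := c) (Set.range F ∪ Set.range y)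
    ((Set.finite_range F).union (Set.finite_range y))
  have hXF : ∀ x, F x ∈ B := fun x => hX (Or.inl ⟨x, rfl⟩)
  have hXy : ∀ x, y x ∈ B := fun x => hX (Or.inr ⟨x, rfl⟩)
  letI : GrLie K c hB.toSub := subGr hB.toSub hB.pr
  haveI : Finite hB.toSub := by
    have : Finite B := Module.finite_of_finite K
    exact this
  let g : hB.toSub →ₗ[K] MM c (Module.End K (UE K L × K)) :=
    (Tri K c _).toSubmodule.subtype ∘ₗ hB.toSub.toSubmodule.subtype
  let f : L →ₗ⁅K⁆ hB.toSub :=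
    { (F : L →ₗ[K] BigT K c L).codRestrict hB.toSub.toSubmodule hXF with
      map_lie' := by
        intro x y
        apply Subtype.ext
        exact F.map_lie x y }
  have hg : Function.Injective g := by
    change Function.Injective ((Tri K c _).toSubmodule.subtype ∘ hB.toSub.toSubmodule.subtype)
    exact (Submodule.subtype_injective _).comp (Submodule.subtype_injective _)
  have hgl : ∀ x y, g ⁅x, y⁆ = g x * g y - g y * g x := fun x y => rfl
  have f1 : Function.Injective f := fun x y h => hFinj (congrArg Subtype.val h)
  have f2 : ∀ i x, f (pr K c i x) = pr K c i (f x) := fun i x => Subtype.ext (hFpr i x)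
  have f3 : ∀ T k δ, Task K c (L := L) T k δ → ∃ y, pr K c k y = y ∧ (∀ t ∈ T, y ≠ f t) ∧
    ∀ t ∈ T, ⁅y, f t⁆ = f (δ t) := by
    intro T k δ h
    have hk := Finset.mem_Icc.1 h.hk
    obtain ⟨h1, h2, h3⟩ := hy (T, ⟨k, by omega⟩, δ) h
    refine ⟨⟨y (T, ⟨k, by omega⟩, δ), hXy _⟩, Subtype.ext h1, ?_, ?_⟩
    · intro t _ hn
      exact h2 t (congrArg Subtype.val hn)
    · intro t ht
      exact Subtype.ext (h3 t ht)
  have hio := io_inj_of g hgl hg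
  exact ⟨⟨hB.toSub, hio⟩, f, f1, f2, f3⟩

end
end Fr

namespace Fr
section Lim
variable {K : Type u} {c : ℕ} [Field K] (F : ℕ → FA K c)
  (f : ∀ n, (F n).carrier →ₗ⁅K⁆ (F (n + 1)).carrier)

def tr {n m : ℕ} (h : n ≤ m) (x : (F n).carrier) : (F m).carrier :=
  Nat.leRecOn (C := fun n => (F n).carrier) h (fun {k} => f k) x

theorem tr_self (n : ℕ) (x : (F n).carrier) : tr F f (le_refl n) x = x :=
  Nat.leRecOn_self (C := fun n => (F n).carrier) (next := fun {k} => f k) x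

theorem tr_succ {n m : ℕ} (h : n ≤ m) (x : (F n).carrier) :
    tr F f (h.trans (Nat.le_succ m)) x = f m (tr F f h x) :=
  Nat.leRecOn_succ (C := fun n => (F n).carrier) (next := fun {k} => f k) h x

theorem tr_left {n m : ℕ} (h : n + 1 ≤ m) (x : (F n).carrier) :
    tr F f h (f n x) = tr F f ((Nat.le_succ n).trans h) x :=
  Nat.leRecOn_succ_left (C := fun n => (F n).carrier) (next := fun {k} => f k) x _ h

theorem tr_add {n m : ℕ} (h : n ≤ m) (x y : (F n).carrier) :
    tr F f h (x + y) = tr F f h x + tr F f h y := by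
  induction m, h using Nat.le_induction with
  | base => simp only [tr_self]
  | succ m h ih => rw [tr_succ _ _ h, tr_succ _ _ h, tr_succ _ _ h, ih, map_add]

theorem tr_smul {n m : ℕ} (h : n ≤ m) (r : K) (x : (F n).carrier) :
    tr F f h (r • x) = r • tr F f h x := by
  induction m, h using Nat.le_induction with
  | base => simp only [tr_self]
  | succ m h ih => rw [tr_succ _ _ h, tr_succ _ _ h, ih, map_smul]

theorem tr_lie {n m : ℕ} (h : n ≤ m) (x y : (F n).carrier) :
    tr F f h ⁅x, y⁆ = ⁅tr F f h x, tr F f h y⁆ := by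
  induction m, h using Nat.le_induction with
  | base => simp only [tr_self]
  | succ m h ih => rw [tr_succ _ _ h, tr_succ _ _ h, tr_succ _ _ h, ih, LieHom.map_lie]

theorem tr_pr (hf : ∀ n, IsExt (F n) (F (n + 1)) (f n)) {n m : ℕ} (h : n ≤ m) (i : ℕ)
    (x : (F n).carrier) : tr F f h (pr K c i x) = pr K c i (tr F f h x) := by
  induction m, h using Nat.le_induction with
  | base => simp only [tr_self]
  | succ m h ih => rw [tr_succ _ _ h, tr_succ _ _ h, ih, (hf m).pr]

theorem tr_inj (hf : ∀ n, IsExt (F n) (F (n + 1)) (f n)) {n m : ℕ} (h : n ≤ m)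
    (x : (F n).carrier) (hx : tr F f h x = 0) : x = 0 := by
  induction m, h using Nat.le_induction with
  | base => simpa only [tr_self] using hx
  | succ m h ih =>
    rw [tr_succ _ _ h] at hx
    exact ih ((hf m).inj (by rw [hx, map_zero]))

abbrev PP := ∀ n, (F n).carrier

instance : LieRing (PP F) where
  bracket a b := fun n => ⁅a n, b n⁆
  add_lie a b d := funext fun n => add_lie (a n) (b n) (d n)
  lie_add a b d := funext fun n => lie_add (a n) (b n) (d n)
  lie_self a := funext fun n => lie_self (a n)
  leibniz_lie a b d := funext fun n => leibniz_lie (a n) (b n) (d n)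

instance : LieAlgebra K (PP F) where
  lie_smul r a b := funext fun n => lie_smul r (a n) (b n)

theorem PP_lie (a b : PP F) (n : ℕ) : ⁅a, b⁆ n = ⁅a n, b n⁆ := rfl

def evz : LieIdeal K (PP F) where
  carrier := {a | ∃ N, ∀ k, N ≤ k → a k = 0}
  add_mem' := by
    rintro a b ⟨N, hN⟩ ⟨N', hN'⟩
    refine ⟨max N N', fun k hk => ?_⟩
    rw [Pi.add_apply, hN k (le_trans (le_max_left _ _) hk), hN' k (le_trans (le_max_right _ _) hk),
      add_zero]
  zero_mem' := ⟨0, fun _ _ => rfl⟩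
  smul_mem' := by
    rintro r a ⟨N, hN⟩
    refine ⟨N, fun k hk => ?_⟩
    rw [Pi.smul_apply, hN k hk, smul_zero]
  lie_mem := by
    rintro a b ⟨N, hN⟩
    refine ⟨N, fun k hk => ?_⟩
    rw [PP_lie, hN k hk, lie_zero]

theorem mem_evz (a : PP F) : a ∈ evz F ↔ ∃ N, ∀ k, N ≤ k → a k = 0 := Iff.rfl

abbrev QQ := PP F ⧸ evz F

def mkL : PP F →ₗ[K] QQ F := (evz F).toSubmodule.mkQ

theorem mkL_surj : Function.Surjective (mkL F) := Submodule.mkQ_surjective _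

theorem mkL_lie (a b : PP F) : mkL F ⁅a, b⁆ = ⁅mkL F a, mkL F b⁆ := rfl

theorem mkL_eq {a b : PP F} : mkL F a = mkL F b ↔ ∃ N, ∀ k, N ≤ k → a k = b k := by
  have : mkL F a = mkL F b ↔ a - b ∈ (evz F).toSubmodule := Submodule.Quotient.eq _
  rw [this]
  constructor
  · rintro ⟨N, h⟩; exact ⟨N, fun k hk => sub_eq_zero.1 (h k hk)⟩
  · rintro ⟨N, h⟩; exact ⟨N, fun k hk => sub_eq_zero.2 (h k hk)⟩

def pP (i : ℕ) : PP F →ₗ[K] PP F := LinearMap.pi fun k => pr K c i ∘ₗ LinearMap.proj k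

theorem pP_apply (i : ℕ) (a : PP F) (k : ℕ) : pP F i a k = pr K c i (a k) := rfl

def pQ (i : ℕ) : QQ F →ₗ[K] QQ F :=
  (evz F).toSubmodule.mapQ (evz F).toSubmodule (pP F i) (by
    rintro a ⟨N, hN⟩
    exact ⟨N, fun k hk => by rw [pP_apply, hN k hk, map_zero]⟩)

theorem pQ_mk (i : ℕ) (a : PP F) : pQ F i (mkL F a) = mkL F (pP F i a) := rfl

instance : GrLie K c (QQ F) where
  pr' i := pQ F i
  pp' i j x := by
    obtain ⟨a, rfl⟩ := mkL_surj F x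
    rw [pQ_mk, pQ_mk]
    have : pP F i (pP F j a) = if i = j then pP F j a else 0 := by
      funext k
      rw [pP_apply, pP_apply, pr_pr]
      split_ifs <;> rfl
    rw [this]
    split_ifs
    · rfl
    · rw [map_zero]
  sm' x := by
    obtain ⟨a, rfl⟩ := mkL_surj F x
    simp only [pQ_mk]
    rw [← map_sum]
    congr 1
    funext k
    rw [Finset.sum_apply]
    exact pr_sum K c (a k)
  lm' i j x y hx hy := by
    obtain ⟨a, rfl⟩ := mkL_surj F x
    obtain ⟨b, rfl⟩ := mkL_surj F y
    rw [← hx, ← hy, pQ_mk, pQ_mk, ← mkL_lie, pQ_mk]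
    congr 1
    funext k
    exact pr_lie K c (pr_self K c i (a k)) (pr_self K c j (b k))

theorem pr_mk (i : ℕ) (a : PP F) : pr K c i (mkL F a) = mkL F (pP F i a) := rfl

def sq (n : ℕ) (x : (F n).carrier) : PP F := fun k => if h : n ≤ k then tr F f h x else 0

theorem sq_apply {n k : ℕ} (h : n ≤ k) (x : (F n).carrier) : sq F f n x k = tr F f h x := dif_pos h

def jj (n : ℕ) : (F n).carrier →ₗ⁅K⁆ QQ F where
  toFun x := mkL F (sq F f n x)
  map_add' x y := by
    rw [← map_add, mkL_eq]
    exact ⟨n, fun k hk => by rw [Pi.add_apply, sq_apply _ _ hk, sq_apply _ _ hk, sq_apply _ _ hk, tr_add]⟩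
  map_smul' r x := by
    rw [RingHom.id_apply, ← map_smul, mkL_eq]
    exact ⟨n, fun k hk => by rw [Pi.smul_apply, sq_apply _ _ hk, sq_apply _ _ hk, tr_smul]⟩
  map_lie' {x y} := by
    rw [← mkL_lie, mkL_eq]
    exact ⟨n, fun k hk => by rw [PP_lie, sq_apply _ _ hk, sq_apply _ _ hk, sq_apply _ _ hk, tr_lie]⟩

theorem jj_apply (n : ℕ) (x : (F n).carrier) : jj F f n x = mkL F (sq F f n x) := rfl

theorem jj_succ (n : ℕ) (x : (F n).carrier) : jj F f (n + 1) (f n x) = jj F f n x := by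
  rw [jj_apply, jj_apply, mkL_eq]
  exact ⟨n + 1, fun k hk => by rw [sq_apply _ _ hk, sq_apply _ _ (by omega), tr_left]⟩

theorem jj_tr {n m : ℕ} (h : n ≤ m) (x : (F n).carrier) : jj F f m (tr F f h x) = jj F f n x := by
  induction m, h using Nat.le_induction with
  | base => simp only [tr_self]
  | succ m h ih => rw [tr_succ _ _ h, jj_succ, ih]

theorem exists_limit (hf : ∀ n, IsExt (F n) (F (n + 1)) (f n)) :
    ∃ (M : Type u) (_ : LieRing M) (_ : LieAlgebra K M) (_ : GrLie K c M)
      (j : ∀ n, (F n).carrier →ₗ⁅K⁆ M), (∀ n, Function.Injective (j n)) ∧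
      (∀ n i x, j n (pr K c i x) = pr K c i (j n x)) ∧ (∀ n x, j (n + 1) (f n x) = j n x) ∧
      (∀ n m, n ≤ m → ∀ x, ∃ y, j m y = j n x) ∧
      ∀ m, ∃ n x, j n x = m := by
  have hpr : ∀ n i x, jj F f n (pr K c i x) = pr K c i (jj F f n x) := by
    intro n i x
    rw [jj_apply, jj_apply, pr_mk, mkL_eq]
    exact ⟨n, fun k hk => by rw [pP_apply, sq_apply _ _ hk, sq_apply _ _ hk, tr_pr F f hf]⟩
  have hinj : ∀ n, Function.Injective (jj F f n) := by
    intro n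
    rw [injective_iff_map_eq_zero]
    intro x hx
    rw [jj_apply, ← map_zero (mkL F), mkL_eq] at hx
    obtain ⟨N, hN⟩ := hx
    have := hN (max n N) (le_max_right _ _)
    rw [sq_apply _ _ (le_max_left _ _)] at this
    exact tr_inj F f hf _ x this
  have two : ∀ n x n' x', ∃ m y y', jj F f m y = jj F f n x ∧ jj F f m y' = jj F f n' x' := by
    intro n x n' x'
    exact ⟨max n n', _, _, jj_tr F f (le_max_left _ _) x, jj_tr F f (le_max_right _ _) x'⟩
  let S : LieSubalgebra K (QQ F) :=
    { carrier := {z | ∃ n x, jj F f n x = z}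
      add_mem' := by
        rintro _ _ ⟨n, x, rfl⟩ ⟨n', x', rfl⟩
        obtain ⟨m, y, y', h, h'⟩ := two n x n' x'
        exact ⟨m, y + y', by rw [map_add, h, h']⟩
      zero_mem' := ⟨0, 0, map_zero _⟩
      smul_mem' := by
        rintro r _ ⟨n, x, rfl⟩
        exact ⟨n, r • x, map_smul _ _ _⟩
      lie_mem' := by
        rintro _ _ ⟨n, x, rfl⟩ ⟨n', x', rfl⟩
        obtain ⟨m, y, y', h, h'⟩ := two n x n' x'
        exact ⟨m, ⁅y, y'⁆, by rw [LieHom.map_lie, h, h']⟩ }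
  have hS : ∀ i, ∀ x ∈ S, pr K c i x ∈ S := by
    rintro i _ ⟨n, x, rfl⟩
    exact ⟨n, pr K c i x, hpr n i x⟩
  have hmem : ∀ n x, jj F f n x ∈ S := fun n x => ⟨n, x, rfl⟩
  let j : ∀ n, (F n).carrier →ₗ⁅K⁆ S := fun n =>
    { (jj F f n : (F n).carrier →ₗ[K] QQ F).codRestrict S.toSubmodule (hmem n) with
      map_lie' := by
        intro x y
        apply Subtype.ext
        exact (jj F f n).map_lie x y }
  have hj : ∀ n x, (j n x : QQ F) = jj F f n x := fun n x => rfl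
  letI : GrLie K c S := subGr S hS
  refine ⟨S, inferInstance, inferInstance, inferInstance, j, ?_, ?_, ?_, ?_, ?_⟩
  · intro n x y h
    exact hinj n (congrArg Subtype.val h)
  · intro n i x
    exact Subtype.ext (hpr n i x)
  · intro n x
    exact Subtype.ext (jj_succ F f n x)
  · intro n m h x
    exact ⟨tr F f h x, Subtype.ext (jj_tr F f h x)⟩
  · rintro ⟨_, n, x, rfl⟩
    exact ⟨n, x, rfl⟩

end Lim

structure Rich (K : Type u) (c : ℕ) (M : Type u) [Field K] [LieRing M] [LieAlgebra K M] [GrLie K c M] :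
    Prop where
  sol : ∀ (T : Submodule K M) k δ, Finite T → Task K c T k δ →
    ∃ y, pr K c k y = y ∧ y ∉ T ∧ ∀ t ∈ T, ⁅y, t⁆ = δ t

theorem exists_seq (K : Type u) (c : ℕ) [Field K] [Finite K] :
    ∃ (F : ℕ → FA K c) (f : ∀ n, (F n).carrier →ₗ⁅K⁆ (F (n + 1)).carrier),
      ∀ n, IsExt (F n) (F (n + 1)) (f n) := by
  letI : LieRing PUnit.{u + 1} :=
    { bracket := fun _ _ => PUnit.unit
      add_lie := fun _ _ _ => rfl
      lie_add := fun _ _ _ => rfl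
      lie_self := fun _ => rfl
      leibniz_lie := fun _ _ _ => rfl }
  letI : LieAlgebra K PUnit.{u + 1} := { lie_smul := fun _ _ _ => rfl }
  letI : GrLie K c PUnit.{u + 1} :=
    { pr' := fun _ => 0
      pp' := fun _ _ _ => rfl
      sm' := fun _ => rfl
      lm' := fun _ _ _ _ _ _ => rfl }
  let A0 : FA K c := ⟨PUnit.{u + 1}, fun _ _ _ => rfl⟩
  choose B f hf using fun A : FA K c => exists_ext A
  let F : ℕ → FA K c := fun n => Nat.rec A0 (fun _ A => B A) n
  exact ⟨F, fun n => f (F n), fun n => hf (F n)⟩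

theorem exists_rich (K : Type u) (c : ℕ) [Field K] [Finite K] :
    ∃ (M : Type u) (_ : LieRing M) (_ : LieAlgebra K M) (_ : GrLie K c M),
      Countable M ∧ Rich K c M := by
  obtain ⟨F, f, hf⟩ := exists_seq K c
  obtain ⟨M, _, _, _, j, hinj, hpr, hsucc, hmono, hsurj⟩ := exists_limit F f hf
  refine ⟨M, inferInstance, inferInstance, inferInstance, ?_, ⟨?_⟩⟩
  · have : Function.Surjective (fun p : (Σ n, (F n).carrier) => j p.1 p.2) := by
      intro m
      obtain ⟨n, x, h⟩ := hsurj m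
      exact ⟨⟨n, x⟩, h⟩
    exact this.countable
  · intro T k δ hT h
    obtain ⟨n, hn⟩ : ∃ n, ∀ t ∈ T, ∃ x, j n x = t := by
      choose N x hx using hsurj
      obtain ⟨n, hn⟩ := (Set.toFinite (Set.range fun t : T => N t)).bddAbove
      refine ⟨n, fun t ht => ?_⟩
      obtain ⟨y, hy⟩ := hmono (N t) n (hn ⟨⟨t, ht⟩, rfl⟩) (x t)
      exact ⟨y, hy.trans (hx t)⟩
    obtain ⟨g, hg⟩ := LinearMap.exists_leftInverse_of_injective (j n : (F n).carrier →ₗ[K] M)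
      (LinearMap.ker_eq_bot.2 (hinj n))
    have hgj : ∀ x, g (j n x) = x := fun x => LinearMap.congr_fun hg x
    have hjg : ∀ t ∈ T, j n (g t) = t := by
      intro t ht
      obtain ⟨x, rfl⟩ := hn t ht
      rw [hgj]
    let T' := T.comap (j n : (F n).carrier →ₗ[K] M)
    have hT' : ∀ x, x ∈ T' ↔ j n x ∈ T := fun x => Iff.rfl
    let δ' : (F n).carrier →ₗ[K] (F n).carrier := g ∘ₗ δ ∘ₗ (j n : (F n).carrier →ₗ[K] M)
    have hδ' : ∀ x, δ' x = g (δ (j n x)) := fun x => rfl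
    have hjδ : ∀ x ∈ T', j n (δ' x) = δ (j n x) := fun x hx => hjg _ (h.mem _ hx)
    have task : Task K c T' k δ' := by
      refine ⟨⟨?_, ?_⟩, h.hk, ?_, ?_, ?_⟩
      · intro x hx y hy
        rw [hT', LieHom.map_lie]
        exact h.gs.lie _ hx _ hy
      · intro i x hx
        rw [hT', hpr]
        exact h.gs.pr _ _ hx
      · intro x hx
        rw [hT', hjδ x hx]
        exact h.mem _ hx
      · intro x hx y hy
        apply hinj n
        rw [map_add, LieHom.map_lie, LieHom.map_lie, hjδ x hx, hjδ y hy, hjδ, LieHom.map_lie]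
        · exact h.der _ hx _ hy
        rw [hT', LieHom.map_lie]
        exact h.gs.lie _ hx _ hy
      · intro i x hx hi
        apply hinj n
        rw [hpr, hjδ x hx]
        apply h.deg i _ hx
        exact (hpr n i x).symm.trans (congrArg (j n) hi)
    obtain ⟨y, hy1, hy2, hy3⟩ := (hf n).sol T' k δ' task
    refine ⟨j (n + 1) y, ?_, ?_, ?_⟩
    · rw [← hpr, hy1]
    · intro hm
      obtain ⟨x, hx⟩ := hn _ hm
      apply hy2 x (by rw [hT', hx]; exact hm)
      apply hinj (n + 1)
      rw [hsucc, hx]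
    · intro t ht
      obtain ⟨x, rfl⟩ := hn t ht
      have := congrArg (j (n + 1)) (hy3 x ht)
      rw [LieHom.map_lie, hsucc, hsucc, hjδ x ht] at this
      exact this
end Fr

namespace Fr
section BF
variable {K : Type u} {c : ℕ} {G H : Type u} [Field K] [LieRing G] [LieAlgebra K G] [GrLie K c G]
  [LieRing H] [LieAlgebra K H] [GrLie K c H]

instance prodGr : GrLie K c (G × H) where
  pr' i := LinearMap.prodMap (pr K c i) (pr K c i)
  pp' i j x := by
    simp only [LinearMap.prodMap_apply, pr_pr]
    split_ifs <;> rfl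
  sm' x := by
    simp only [LinearMap.prodMap_apply]
    ext
    · rw [Prod.fst_sum]; exact pr_sum K c x.1
    · rw [Prod.snd_sum]; exact pr_sum K c x.2
  lm' i j x y hx hy := by
    exact Prod.ext (pr_lie K c (congrArg Prod.fst hx) (congrArg Prod.fst hy))
      (pr_lie K c (congrArg Prod.snd hx) (congrArg Prod.snd hy))

theorem pr_prod (i : ℕ) (p : G × H) : pr K c i p = (pr K c i p.1, pr K c i p.2) := rfl

theorem lie_prod (p q : G × H) : ⁅p, q⁆ = (⁅p.1, q.1⁆, ⁅p.2, q.2⁆) := rfl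

variable (K c) in
/-- finite partial isomorphisms -/
structure PI (Γ : Submodule K (G × H)) : Prop where
  fin : FiniteDimensional K Γ
  gs : GS K c Γ
  l : ∀ y, ((0 : G), y) ∈ Γ → y = 0
  r : ∀ x, (x, (0 : H)) ∈ Γ → x = 0

theorem PI.lu {Γ : Submodule K (G × H)} (h : PI K c Γ) {x : G} {y z : H} (hy : (x, y) ∈ Γ)
    (hz : (x, z) ∈ Γ) : y = z := by
  have := Γ.sub_mem hy hz
  rw [Prod.mk_sub_mk, sub_self] at this
  exact sub_eq_zero.1 (h.l _ this)

theorem PI.ru {Γ : Submodule K (G × H)} (h : PI K c Γ) {x z : G} {y : H} (hy : (x, y) ∈ Γ)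
    (hz : (z, y) ∈ Γ) : x = z := by
  have := Γ.sub_mem hy hz
  rw [Prod.mk_sub_mk, sub_self] at this
  exact sub_eq_zero.1 (h.r _ this)

theorem PI.lin {Γ : Submodule K (G × H)} (h : PI K c Γ) :
    ∃ α : G →ₗ[K] H, ∀ s t, (s, t) ∈ Γ → α s = t := by
  obtain ⟨α, hα⟩ := LinearMap.exists_extend Γ.toLinearPMap.toFun
  refine ⟨α, fun s t hst => ?_⟩
  have hs : s ∈ Γ.map (LinearMap.fst K G H) := ⟨_, hst, rfl⟩
  have h1 := Submodule.mem_graph_toLinearPMap (g := Γ)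
    (fun x hx hx' => h.l _ (by rw [← hx']; exact hx)) ⟨s, hs⟩
  rw [h.lu hst h1]
  exact LinearMap.congr_fun hα ⟨s, hs⟩

def sw (Γ : Submodule K (G × H)) : Submodule K (H × G) :=
  Γ.map (LinearEquiv.prodComm K G H : (G × H) →ₗ[K] (H × G))

theorem mem_sw {Γ : Submodule K (G × H)} {x : G} {y : H} : (y, x) ∈ sw Γ ↔ (x, y) ∈ Γ := by
  constructor
  · rintro ⟨⟨a, b⟩, h, h2⟩
    have h3 : b = y := congrArg Prod.fst h2
    have h4 : a = x := congrArg Prod.snd h2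
    rw [← h3, ← h4]; exact h
  · intro h; exact ⟨_, h, rfl⟩

theorem sw_sw (Γ : Submodule K (G × H)) : sw (sw Γ) = Γ := by
  ext ⟨x, y⟩
  rw [mem_sw, mem_sw]

theorem sw_mono {Γ Δ : Submodule K (G × H)} (h : Γ ≤ Δ) : sw Γ ≤ sw Δ := Submodule.map_mono h

theorem PI.sw {Γ : Submodule K (G × H)} (h : PI K c Γ) : PI K c (sw Γ) := by
  haveI := h.fin
  refine ⟨?_, ⟨?_, ?_⟩, ?_, ?_⟩
  · unfold Fr.sw; infer_instance
  · rintro ⟨a, b⟩ hx ⟨a', b'⟩ hy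
    rw [mem_sw] at hx hy
    rw [lie_prod, mem_sw]
    exact h.gs.lie _ hx _ hy
  · rintro i ⟨a, b⟩ hx
    rw [mem_sw] at hx
    rw [pr_prod, mem_sw]
    exact h.gs.pr i _ hx
  · intro y hy
    rw [mem_sw] at hy
    exact h.r y hy
  · intro y hy
    rw [mem_sw] at hy
    exact h.l y hy

abbrev dom (Γ : Submodule K (G × H)) : Submodule K G := Γ.map (LinearMap.fst K G H)

theorem mem_dom {Γ : Submodule K (G × H)} {x : G} : x ∈ dom Γ ↔ ∃ y, (x, y) ∈ Γ := by
  constructor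
  · rintro ⟨⟨a, b⟩, h, rfl⟩; exact ⟨b, h⟩
  · rintro ⟨y, h⟩; exact ⟨_, h, rfl⟩

theorem PI.domGS {Γ : Submodule K (G × H)} (h : PI K c Γ) : GS K c (dom Γ) := by
  refine ⟨?_, ?_⟩
  · intro x hx y hy
    obtain ⟨x', hx⟩ := mem_dom.1 hx
    obtain ⟨y', hy⟩ := mem_dom.1 hy
    exact mem_dom.2 ⟨_, h.gs.lie _ hx _ hy⟩
  · intro i x hx
    obtain ⟨x', hx⟩ := mem_dom.1 hx
    exact mem_dom.2 ⟨_, h.gs.pr i _ hx⟩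

theorem PI.step [Finite K] (hH : Rich K c H) {Γ : Submodule K (G × H)} (h : PI K c Γ) {k : ℕ}
    (hk : k ∈ Finset.Icc 1 c) {x : G} (hx : pr K c k x = x) (hxn : x ∉ dom Γ)
    (hxl : ∀ b ∈ dom Γ, ⁅x, b⁆ ∈ dom Γ) : ∃ y : H, PI K c (Γ ⊔ K ∙ (x, y)) := by
  obtain ⟨α, hα⟩ := h.lin
  obtain ⟨β, hβ⟩ := h.sw.lin
  haveI := h.fin
  haveI := h.sw.fin
  let δ : H →ₗ[K] H := α ∘ₗ brk (K := K) x ∘ₗ β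
  have hδ : ∀ s t, (s, t) ∈ Γ → (⁅x, s⁆, δ t) ∈ Γ := by
    intro s t hst
    have h1 : β t = s := hβ t s (mem_sw.2 hst)
    obtain ⟨z, hz⟩ := mem_dom.1 (hxl s (mem_dom.2 ⟨t, hst⟩))
    have h2 : δ t = z := by
      change α ⁅x, β t⁆ = z
      rw [h1]; exact hα _ _ hz
    rw [h2]; exact hz
  have hT : ∀ t, t ∈ dom (Fr.sw Γ) ↔ ∃ s, (s, t) ∈ Γ := by
    intro t; rw [mem_dom]; simp only [mem_sw]
  have task : Task K c (dom (Fr.sw Γ)) k δ := by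
    refine ⟨h.sw.domGS, hk, ?_, ?_, ?_⟩
    · intro t ht
      obtain ⟨s, hs⟩ := (hT t).1 ht
      exact (hT _).2 ⟨_, hδ s t hs⟩
    · intro a ha b hb
      obtain ⟨s, hs⟩ := (hT a).1 ha
      obtain ⟨s', hs'⟩ := (hT b).1 hb
      have h1 := hδ _ _ (h.gs.lie _ hs _ hs')
      have h2 := Γ.add_mem (h.gs.lie _ (hδ _ _ hs) _ hs') (h.gs.lie _ hs _ (hδ _ _ hs'))
      simp only [lie_prod, Prod.mk_add_mk] at h1 h2
      rw [leibniz_lie] at h1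
      exact h.lu h1 h2
    · intro i t ht hi
      obtain ⟨s, hs⟩ := (hT t).1 ht
      have h1 := h.gs.pr i _ hs
      rw [pr_prod] at h1
      simp only [hi] at h1
      have h2 : pr K c i s = s := h.ru h1 hs
      have h3 := h.gs.pr (k + i) _ (hδ _ _ hs)
      rw [pr_prod] at h3
      simp only [pr_lie K c hx h2] at h3
      exact h.lu h3 (hδ _ _ hs)
  haveI : Finite (dom (Fr.sw Γ)) := Module.finite_of_finite K
  obtain ⟨y, hy1, hy2, hy3⟩ := hH.sol _ k δ inferInstance task
  have hmem : ∀ p : G × H, p ∈ Γ ⊔ K ∙ (x, y) → ∃ a b, ∃ r : K, (a, b) ∈ Γ ∧ p = (a + r • x, b + r • y) := by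
    intro p hp
    obtain ⟨⟨a, b⟩, ha, r, rfl⟩ : ∃ a' ∈ Γ, ∃ r : K, a' + r • (x, y) = p := by
      simpa only [Submodule.mem_sup, Submodule.mem_span_singleton, exists_exists_eq_and] using hp
    exact ⟨a, b, r, ha, rfl⟩
  refine ⟨y, ?_, ?_, ?_, ?_⟩
  · infer_instance
  · apply h.gs.sup (k := k)
    · rw [pr_prod, hx, hy1]
    · rintro ⟨s, t⟩ hst
      rw [lie_prod]
      simp only
      rw [hy3 t ((hT t).2 ⟨s, hst⟩)]
      exact hδ s t hst
  · intro z hz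
    obtain ⟨a, b, r, hab, he⟩ := hmem _ hz
    obtain ⟨h1, h2⟩ := Prod.mk.inj he
    by_cases hr : r = 0
    · subst hr
      rw [zero_smul, add_zero] at h1 h2
      apply h.l
      rw [h1, h2]; exact hab
    · exfalso; apply hxn
      have : x = (-r⁻¹) • a := by
        rw [eq_neg_of_add_eq_zero_left h1.symm, smul_neg, neg_smul, neg_neg, smul_smul,
          inv_mul_cancel₀ hr, one_smul]
      rw [this]
      exact (dom Γ).smul_mem _ (mem_dom.2 ⟨b, hab⟩)
  · intro z hz
    obtain ⟨a, b, r, hab, he⟩ := hmem _ hz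
    obtain ⟨h1, h2⟩ := Prod.mk.inj he
    by_cases hr : r = 0
    · subst hr
      rw [zero_smul, add_zero] at h1 h2
      apply h.r
      rw [h1, h2]; exact hab
    · exfalso; apply hy2
      have : y = (-r⁻¹) • b := by
        rw [eq_neg_of_add_eq_zero_left h2.symm, smul_neg, neg_smul, neg_neg, smul_smul,
          inv_mul_cancel₀ hr, one_smul]
      rw [this]
      exact (dom (Fr.sw Γ)).smul_mem _ ((hT _).2 ⟨a, hab⟩)

theorem PI.forth [Finite K] (hH : Rich K c H) {Γ : Submodule K (G × H)} (h : PI K c Γ) (x : G) :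
    ∃ Δ, PI K c Δ ∧ Γ ≤ Δ ∧ ∃ y, (x, y) ∈ Δ := by
  haveI := h.fin
  haveI : Finite (dom Γ) := Module.finite_of_finite K
  obtain ⟨S, hS, hXS, hfin⟩ := exists_fin_GS (K := K) (c := c) ((dom Γ : Set G) ∪ {x})
    ((Set.toFinite _).union (Set.finite_singleton x))
  have key : ∀ n : ℕ, ∀ Γ : Submodule K (G × H), PI K c Γ → dom Γ ≤ S →
      Module.finrank K S ≤ Module.finrank K (dom Γ) + n → ∃ Δ, PI K c Δ ∧ Γ ≤ Δ ∧ S ≤ dom Δ := by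
    intro n
    induction n with
    | zero =>
      intro Γ h hle hf
      exact ⟨Γ, h, le_rfl, (Submodule.eq_of_le_of_finrank_le hle hf).ge⟩
    | succ n ih =>
      intro Γ h hle hf
      rcases hle.eq_or_lt with he | hlt
      · exact ⟨Γ, h, le_rfl, he.ge⟩
      obtain ⟨k, hk, x, hxS, hx, hxn, hxl⟩ := exists_step h.domGS hS hlt
      obtain ⟨y, hy⟩ := h.step hH hk hx hxn hxl
      have hle' : dom (Γ ⊔ K ∙ (x, y)) ≤ S := by
        rw [dom, Submodule.map_sup, Submodule.map_span, Set.image_singleton]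
        refine sup_le hle ?_
        rw [Submodule.span_singleton_le_iff_mem]
        exact hxS
      have hlt' : dom Γ < dom (Γ ⊔ K ∙ (x, y)) := by
        refine lt_of_le_of_ne (Submodule.map_mono le_sup_left) fun he => hxn ?_
        rw [he]
        exact mem_dom.2 ⟨y, Submodule.mem_sup_right (Submodule.mem_span_singleton_self _)⟩
      haveI := hy.fin
      have := Submodule.finrank_lt_finrank_of_lt hlt'
      obtain ⟨Δ, h1, h2, h3⟩ := ih _ hy hle' (by omega)
      exact ⟨Δ, h1, le_sup_left.trans h2, h3⟩
  obtain ⟨Δ, h1, h2, h3⟩ := key _ Γ h (fun z hz => hXS (Or.inl hz)) (Nat.le_add_left _ _)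
  exact ⟨Δ, h1, h2, mem_dom.1 (h3 (hXS (Or.inr rfl)))⟩

theorem PI.back [Finite K] (hG : Rich K c G) {Γ : Submodule K (G × H)} (h : PI K c Γ) (y : H) :
    ∃ Δ, PI K c Δ ∧ Γ ≤ Δ ∧ ∃ x, (x, y) ∈ Δ := by
  obtain ⟨Δ, h1, h2, x, h3⟩ := h.sw.forth hG y
  refine ⟨Fr.sw Δ, h1.sw, ?_, x, mem_sw.2 h3⟩
  rw [← sw_sw Γ]
  exact sw_mono h2

theorem exists_hom (I : Set (Submodule K (G × H))) (hI : ∀ Γ ∈ I, PI K c Γ)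
    (hd : ∀ Γ ∈ I, ∀ Δ ∈ I, ∃ Λ ∈ I, Γ ≤ Λ ∧ Δ ≤ Λ) (ht : ∀ x : G, ∃ Γ ∈ I, ∃ y, (x, y) ∈ Γ) :
    ∃ f : G →ₗ⁅K⁆ H, Function.Injective f ∧ (∀ i x, f (pr K c i x) = pr K c i (f x)) ∧
      ∀ Γ ∈ I, ∀ x y, (x, y) ∈ Γ → f x = y := by
  choose Γ hΓ f hf using ht
  have key : ∀ Δ ∈ I, ∀ x y, (x, y) ∈ Δ → f x = y := by
    intro Δ hΔ x y hxy
    obtain ⟨Λ, hΛ, h1, h2⟩ := hd _ (hΓ x) _ hΔ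
    exact (hI Λ hΛ).lu (h1 (hf x)) (h2 hxy)
  have two : ∀ x y, ∃ Λ ∈ I, (x, f x) ∈ Λ ∧ (y, f y) ∈ Λ := by
    intro x y
    obtain ⟨Λ, hΛ, h1, h2⟩ := hd _ (hΓ x) _ (hΓ y)
    exact ⟨Λ, hΛ, h1 (hf x), h2 (hf y)⟩
  refine ⟨{ toFun := f, map_add' := ?_, map_smul' := ?_, map_lie' := ?_ }, ?_, ?_, key⟩
  · intro x y
    obtain ⟨Λ, hΛ, h1, h2⟩ := two x y
    exact key Λ hΛ _ _ (Λ.add_mem h1 h2)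
  · intro r x
    exact key _ (hΓ x) _ _ ((Γ x).smul_mem r (hf x))
  · intro x y
    obtain ⟨Λ, hΛ, h1, h2⟩ := two x y
    exact key Λ hΛ _ _ ((hI Λ hΛ).gs.lie _ h1 _ h2)
  · intro x y hxy
    obtain ⟨Λ, hΛ, h1, h2⟩ := two x y
    change f x = f y at hxy
    rw [hxy] at h1
    exact (hI Λ hΛ).ru h1 h2
  · intro i x
    exact key _ (hΓ x) _ _ ((hI _ (hΓ x)).gs.pr i _ (hf x))

theorem exists_embed [Finite K] [Countable G] (hH : Rich K c H) :
    ∃ f : G →ₗ⁅K⁆ H, Function.Injective f ∧ ∀ i x, f (pr K c i x) = pr K c i (f x) := by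
  have h0 : PI K c (⊥ : Submodule K (G × H)) := by
    refine ⟨inferInstance, ⟨?_, ?_⟩, ?_, ?_⟩
    · rintro x hx y hy
      rw [Submodule.mem_bot] at hx
      rw [hx, zero_lie]; exact Submodule.zero_mem _
    · intro i x hx
      rw [Submodule.mem_bot] at hx
      rw [hx, map_zero]; exact Submodule.zero_mem _
    · intro y hy
      exact congrArg Prod.snd ((Submodule.mem_bot K).1 hy)
    · intro y hy
      exact congrArg Prod.fst ((Submodule.mem_bot K).1 hy)
  let P := {Γ : Submodule K (G × H) // PI K c Γ}
  let D : G → Order.Cofinal P := fun x =>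
    { carrier := {Γ | ∃ y, (x, y) ∈ Γ.1}
      isCofinal := by
        intro Γ
        obtain ⟨Δ, h1, h2, h3⟩ := Γ.2.forth hH x
        exact ⟨⟨Δ, h1⟩, h3, h2⟩ }
  haveI : Encodable G := Encodable.ofCountable G
  let I := Order.idealOfCofinals (⟨⊥, h0⟩ : P) D
  obtain ⟨f, h1, h2, -⟩ := exists_hom (K := K) (c := c) (G := G) (H := H) (Subtype.val '' (I : Set P))
    (by rintro _ ⟨Γ, -, rfl⟩; exact Γ.2)
    (by
      rintro _ ⟨Γ, hΓ, rfl⟩ _ ⟨Δ, hΔ, rfl⟩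
      obtain ⟨Λ, hΛ, h1, h2⟩ := I.directed Γ hΓ Δ hΔ
      exact ⟨_, ⟨Λ, hΛ, rfl⟩, h1, h2⟩)
    (by
      intro x
      obtain ⟨Γ, h1, h2⟩ := Order.cofinal_meets_idealOfCofinals (⟨⊥, h0⟩ : P) D x
      exact ⟨_, ⟨Γ, h2, rfl⟩, h1⟩)
  exact ⟨f, h1, h2⟩

theorem exists_iso [Finite K] [Countable G] [Countable H] (hG : Rich K c G) (hH : Rich K c H)
    (Γ₀ : Submodule K (G × H)) (h0 : PI K c Γ₀) :
    ∃ f : G →ₗ⁅K⁆ H, Function.Bijective f ∧ (∀ i x, f (pr K c i x) = pr K c i (f x)) ∧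
      ∀ x y, (x, y) ∈ Γ₀ → f x = y := by
  let P := {Γ : Submodule K (G × H) // PI K c Γ}
  let D : G ⊕ H → Order.Cofinal P := fun z => match z with
    | Sum.inl x =>
      { carrier := {Γ | ∃ y, (x, y) ∈ Γ.1}
        isCofinal := by
          intro Γ
          obtain ⟨Δ, h1, h2, h3⟩ := Γ.2.forth hH x
          exact ⟨⟨Δ, h1⟩, h3, h2⟩ }
    | Sum.inr y =>
      { carrier := {Γ | ∃ x, (x, y) ∈ Γ.1}
        isCofinal := by
          intro Γ
          obtain ⟨Δ, h1, h2, h3⟩ := Γ.2.back hG y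
          exact ⟨⟨Δ, h1⟩, h3, h2⟩ }
  haveI : Encodable (G ⊕ H) := Encodable.ofCountable _
  let I := Order.idealOfCofinals (⟨Γ₀, h0⟩ : P) D
  obtain ⟨f, h1, h2, h3⟩ := exists_hom (K := K) (c := c) (G := G) (H := H) (Subtype.val '' (I : Set P))
    (by rintro _ ⟨Γ, -, rfl⟩; exact Γ.2)
    (by
      rintro _ ⟨Γ, hΓ, rfl⟩ _ ⟨Δ, hΔ, rfl⟩
      obtain ⟨Λ, hΛ, h1, h2⟩ := I.directed Γ hΓ Δ hΔ
      exact ⟨_, ⟨Λ, hΛ, rfl⟩, h1, h2⟩)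
    (by
      intro x
      obtain ⟨Γ, h1, h2⟩ := Order.cofinal_meets_idealOfCofinals (⟨Γ₀, h0⟩ : P) D (Sum.inl x)
      exact ⟨_, ⟨Γ, h2, rfl⟩, h1⟩)
  refine ⟨f, ⟨h1, ?_⟩, h2, ?_⟩
  · intro y
    obtain ⟨Γ, ⟨x, hx⟩, h4⟩ := Order.cofinal_meets_idealOfCofinals (⟨Γ₀, h0⟩ : P) D (Sum.inr y)
    exact ⟨x, h3 _ ⟨Γ, h4, rfl⟩ _ _ hx⟩
  · intro x y hxy
    exact h3 _ ⟨_, Order.mem_idealOfCofinals (⟨Γ₀, h0⟩ : P) D, rfl⟩ _ _ hxy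

end BF
end Fr

namespace Fr

theorem toGr {K : Type u} [Field K] {c : ℕ} (M : CNilpGradedLieAlg K c) :
    ∃ _ : GrLie K c M, ∀ i (x : M), pr K c i x = x ↔ x ∈ M.piece i := by
  classical
  letI := M.isInternal.chooseDecomposition
  let p : ℕ → M.carrier →ₗ[K] M.carrier := fun i =>
    (M.piece i).subtype ∘ₗ DirectSum.component K ℕ (fun i => M.piece i) i ∘ₗ
      (DirectSum.decomposeLinearEquiv M.piece : M.carrier →ₗ[K] _)
  have hp : ∀ i x, p i x = (DirectSum.decompose M.piece x i : M.carrier) := fun i x => rfl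
  have pm : ∀ i x, p i x ∈ M.piece i := fun i x => by rw [hp]; exact SetLike.coe_mem _
  have hs : ∀ i x, x ∈ M.piece i → p i x = x := fun i x hx => by
    rw [hp]; exact DirectSum.decompose_of_mem_same _ hx
  have hn : ∀ i j x, x ∈ M.piece j → i ≠ j → p i x = 0 := fun i j x hx hij => by
    rw [hp]; exact DirectSum.decompose_of_mem_ne _ hx (Ne.symm hij)
  have hiff : ∀ i x, p i x = x ↔ x ∈ M.piece i := fun i x =>
    ⟨fun h => by rw [← h]; exact pm i x, hs i x⟩
  refine ⟨⟨p, ?_, ?_, ?_⟩, hiff⟩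
  · intro i j x
    split_ifs with h
    · subst h; exact hs _ _ (pm _ _)
    · exact hn _ _ _ (pm _ _) h
  · intro x
    have hx : x ∈ ⨆ i, M.piece i := by
      rw [M.isInternal.submodule_iSup_eq_top]; trivial
    induction hx using Submodule.iSup_induction' with
    | mem j x hx =>
      by_cases hj : j ∈ Finset.Icc 1 c
      · rw [Finset.sum_eq_single j, hs j x hx]
        · intro b _ hb; exact hn _ _ _ hx hb
        · intro h; exact absurd hj h
      · have : x = 0 := by
          rw [Finset.mem_Icc] at hj
          rcases Nat.eq_zero_or_pos j with h0 | h0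
          · subst h0; rw [M.piece_zero] at hx; exact hx
          · rw [M.piece_of_gt j (by omega)] at hx; exact hx
        rw [this]; simp
    | zero => simp
    | add x y _ _ hx hy => simp only [map_add, Finset.sum_add_distrib, hx, hy]
  · intro i j x y hx hy
    rw [hiff] at hx hy ⊢
    exact M.lie_mem i j x y hx hy

def mkC (K : Type u) [Field K] (c : ℕ) (M : Type u) [LieRing M] [LieAlgebra K M] [GrLie K c M] :
    CNilpGradedLieAlg K c where
  carrier := M
  piece i := LinearMap.ker (pr K c i - LinearMap.id : M →ₗ[K] M)
  isInternal := by
    have hm : ∀ i (x : M), x ∈ LinearMap.ker (pr K c i - LinearMap.id : M →ₗ[K] M) ↔ pr K c i x = x := by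
      intro i x
      rw [LinearMap.mem_ker, LinearMap.sub_apply, sub_eq_zero, LinearMap.id_apply]
    apply DirectSum.isInternal_submodule_of_iSupIndep_of_iSup_eq_top
    · intro i
      rw [Submodule.disjoint_def]
      intro x hx hx2
      have hle : (⨆ j, ⨆ (_ : j ≠ i), LinearMap.ker (pr K c j - LinearMap.id : M →ₗ[K] M)) ≤
          LinearMap.ker (pr K c i : M →ₗ[K] M) := by
        refine iSup_le fun j => iSup_le fun hj => ?_
        intro z hz
        rw [hm] at hz
        rw [LinearMap.mem_ker, pr_hom K c hz, if_neg (Ne.symm hj)]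
      rw [hm] at hx
      rw [← hx]
      exact hle hx2
    · rw [eq_top_iff]
      intro x _
      rw [← pr_sum K c x]
      refine Submodule.sum_mem _ fun i _ => ?_
      exact Submodule.mem_iSup_of_mem i ((hm i _).2 (pr_self K c i x))
  piece_zero := by
    rw [eq_bot_iff]
    intro x hx
    rw [LinearMap.mem_ker, LinearMap.sub_apply, sub_eq_zero] at hx
    exact hom_out K c (by simp) hx
  piece_of_gt n hn := by
    rw [eq_bot_iff]
    intro x hx
    rw [LinearMap.mem_ker, LinearMap.sub_apply, sub_eq_zero] at hx
    exact hom_out K c (by rw [Finset.mem_Icc]; omega) hx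
  lie_mem i j x y hx hy := by
    rw [LinearMap.mem_ker, LinearMap.sub_apply, sub_eq_zero] at hx hy ⊢
    exact pr_lie K c hx hy

theorem main_aux {K : Type u} [Field K] [Finite K] {c : ℕ} (M₀ : CNilpGradedLieAlg K c)
    [GrLie K c M₀] (hp : ∀ i (x : M₀), pr K c i x = x ↔ x ∈ M₀.piece i) [Countable M₀]
    (hR : Rich K c M₀) :
      (∀ M : CNilpGradedLieAlg K c, Countable M →
        ∃ f : M →ₗ⁅K⁆ M₀, Function.Injective f ∧ LieHomIsGraded M M₀ f) ∧
      (∀ S T : LieSubalgebra K M₀, LieSubalgIsGraded M₀ S → LieSubalgIsGraded M₀ T →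
        LieSubalgFG M₀ S → LieSubalgFG M₀ T →
        ∀ e : S ≃ₗ⁅K⁆ T,
          (∀ i (x : S), (x : M₀.carrier) ∈ M₀.piece i → (e x : M₀.carrier) ∈ M₀.piece i) →
          (∀ i (y : T), (y : M₀.carrier) ∈ M₀.piece i → (e.symm y : M₀.carrier) ∈ M₀.piece i) →
          ∃ σ : M₀ ≃ₗ⁅K⁆ M₀,
            (∀ i (x : M₀.carrier), x ∈ M₀.piece i → σ x ∈ M₀.piece i) ∧
            (∀ i (x : M₀.carrier), x ∈ M₀.piece i → σ.symm x ∈ M₀.piece i) ∧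
            ∀ x : S, σ (x : M₀.carrier) = (e x : M₀.carrier)) := by
  constructor
  · intro M hM
    obtain ⟨_, hq⟩ := toGr M
    obtain ⟨f, h1, h2⟩ := exists_embed (G := M) hR
    refine ⟨f, h1, fun i x hx => ?_⟩
    rw [← hp, ← h2, (hq i x).2 hx]
  · intro S T hS hT hSf hTf e he he'
    have hSfin : FiniteDimensional K S := by
      obtain ⟨s, rfl⟩ := hSf
      obtain ⟨B, hB, hX, hfin⟩ := exists_fin_GS (K := K) (c := c) (s : Set M₀) s.finite_toSet
      have hle : LieSubalgebra.lieSpan K M₀ (s : Set M₀) ≤ hB.toSub := LieSubalgebra.lieSpan_le.2 hX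
      have hle' : (LieSubalgebra.lieSpan K M₀ (s : Set M₀)).toSubmodule ≤ B := hle
      exact Submodule.finiteDimensional_of_le hle'
    let g : S →ₗ[K] M₀ × M₀ := LinearMap.prod S.toSubmodule.subtype
      (T.toSubmodule.subtype ∘ₗ (e : S →ₗ[K] T))
    have hg : ∀ x, g x = ((x : M₀.carrier), (e x : M₀.carrier)) := fun x => rfl
    have hprS : ∀ i (x : S), ∃ y : S, g y = pr K c i (g x) := by
      rintro i ⟨x, hx⟩
      have hx' : x ∈ ⨆ i, S.toSubmodule ⊓ M₀.piece i := by
        rw [← hS]; exact hx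
      have : ∃ y : S, ∀ z : S, (z : M₀.carrier) = x → g y = pr K c i (g z) := by
        clear hx
        induction hx' using Submodule.iSup_induction' with
        | mem j x hx =>
          obtain ⟨h1, h2⟩ := hx
          have h3 := he j ⟨x, h1⟩ h2
          have h4 := (hp _ _).2 h2
          have h5 := (hp _ _).2 h3
          by_cases hij : i = j
          · subst hij
            refine ⟨⟨x, h1⟩, fun z hz => ?_⟩
            obtain rfl : z = ⟨x, h1⟩ := Subtype.ext hz
            rw [hg, pr_prod]
            exact Prod.ext h4.symm h5.symm
          · refine ⟨0, fun z hz => ?_⟩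
            obtain rfl : z = ⟨x, h1⟩ := Subtype.ext hz
            rw [hg ⟨x, h1⟩, pr_prod, map_zero]
            exact Prod.ext ((pr_hom K c h4 i).trans (if_neg hij)).symm
              ((pr_hom K c h5 i).trans (if_neg hij)).symm
        | zero =>
          refine ⟨0, fun z hz => ?_⟩
          obtain rfl : z = 0 := Subtype.ext hz
          simp only [map_zero]
        | add x y hx hy ihx ihy =>
          obtain ⟨a, ha⟩ := ihx
          obtain ⟨b, hb⟩ := ihy
          rw [← hS] at hx hy
          refine ⟨a + b, fun z hz => ?_⟩
          obtain rfl : z = (⟨x, hx⟩ : S) + ⟨y, hy⟩ := Subtype.ext hz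
          rw [map_add, ha ⟨x, hx⟩ rfl, hb ⟨y, hy⟩ rfl, map_add, map_add]
      obtain ⟨y, hy⟩ := this
      exact ⟨y, hy ⟨x, hx⟩ rfl⟩
    have hPI : PI K c (LinearMap.range g) := by
      refine ⟨inferInstance, ⟨?_, ?_⟩, ?_, ?_⟩
      · rintro _ ⟨x, rfl⟩ _ ⟨y, rfl⟩
        refine ⟨⁅x, y⁆, ?_⟩
        rw [hg, hg, hg, lie_prod, LieEquiv.map_lie]
        rfl
      · rintro i _ ⟨x, rfl⟩
        exact hprS i x
      · rintro y ⟨x, hx⟩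
        obtain ⟨h1, h2⟩ := Prod.mk.inj ((hg x).symm.trans hx)
        have : x = 0 := Subtype.ext h1
        rw [← h2, this, map_zero]; rfl
      · rintro y ⟨x, hx⟩
        obtain ⟨h1, h2⟩ := Prod.mk.inj ((hg x).symm.trans hx)
        have h3 : e x = 0 := Subtype.ext h2
        have : x = 0 := e.injective (h3.trans (map_zero e).symm)
        rw [← h1, this]; rfl
    obtain ⟨f, hb, hpr, hext⟩ := exists_iso hR hR _ hPI
    let σ := LieEquiv.ofBijective f hb
    have hσ : ∀ x, σ x = f x := fun x => rfl
    refine ⟨σ, ?_, ?_, ?_⟩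
    · intro i x hx
      rw [← hp] at hx ⊢
      rw [hσ, ← hpr, hx]
    · intro i x hx
      rw [← hp] at hx ⊢
      apply hb.1
      have h1 : f (σ.symm x) = x := σ.apply_symm_apply x
      rw [hpr, h1, hx]
    · intro x
      rw [hσ]
      exact hext _ _ ⟨x, rfl⟩

theorem main_thm (K : Type u) [Field K] [Finite K] (c : ℕ) :
    ∃ M₀ : CNilpGradedLieAlg K c, Countable M₀ ∧
      (∀ M : CNilpGradedLieAlg K c, Countable M →
        ∃ f : M →ₗ⁅K⁆ M₀, Function.Injective f ∧ LieHomIsGraded M M₀ f) ∧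
      (∀ S T : LieSubalgebra K M₀, LieSubalgIsGraded M₀ S → LieSubalgIsGraded M₀ T →
        LieSubalgFG M₀ S → LieSubalgFG M₀ T →
        ∀ e : S ≃ₗ⁅K⁆ T,
          (∀ i (x : S), (x : M₀.carrier) ∈ M₀.piece i → (e x : M₀.carrier) ∈ M₀.piece i) →
          (∀ i (y : T), (y : M₀.carrier) ∈ M₀.piece i → (e.symm y : M₀.carrier) ∈ M₀.piece i) →
          ∃ σ : M₀ ≃ₗ⁅K⁆ M₀,
            (∀ i (x : M₀.carrier), x ∈ M₀.piece i → σ x ∈ M₀.piece i) ∧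
            (∀ i (x : M₀.carrier), x ∈ M₀.piece i → σ.symm x ∈ M₀.piece i) ∧
            ∀ x : S, σ (x : M₀.carrier) = (e x : M₀.carrier)) := by
  obtain ⟨M, i1, i2, i3, hc, hR⟩ := exists_rich K c
  have i4 : Countable (mkC K c M) := hc
  let i5 : GrLie K c (mkC K c M) := i3
  refine ⟨mkC K c M, i4, main_aux (mkC K c M) ?_ hR⟩
  have key : ∀ i (x : M), pr K c i x = x ↔ x ∈ LinearMap.ker (pr K c i - LinearMap.id : M →ₗ[K] M) := by
    intro i x
    rw [LinearMap.mem_ker, LinearMap.sub_apply, sub_eq_zero, LinearMap.id_apply]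
  exact key

end Fr

/-- for a finite field `K` and `c ≥ 1` there is a countable
`c`-nilpotent graded Lie algebra `M₀` over `K` which is (i) universal for all at
most countable `c`-nilpotent graded Lie algebras over `K` and (ii) ultrahomogeneous:
any graded isomorphism between finitely generated graded subalgebras extends to a
graded automorphism of `M₀`. -/
theorem exists_cNilpGradedLieAlg_fraisseLimit (K : Type u) [Field K] [Finite K]
    (c : ℕ) (hc : 1 ≤ c) :
    ∃ M₀ : CNilpGradedLieAlg K c, Countable M₀ ∧
      (∀ M : CNilpGradedLieAlg K c, Countable M →
        ∃ f : M →ₗ⁅K⁆ M₀, Function.Injective f ∧ LieHomIsGraded M M₀ f) ∧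
      (∀ S T : LieSubalgebra K M₀, LieSubalgIsGraded M₀ S → LieSubalgIsGraded M₀ T →
        LieSubalgFG M₀ S → LieSubalgFG M₀ T →
        ∀ e : S ≃ₗ⁅K⁆ T,
          (∀ i (x : S), (x : M₀.carrier) ∈ M₀.piece i → (e x : M₀.carrier) ∈ M₀.piece i) →
          (∀ i (y : T), (y : M₀.carrier) ∈ M₀.piece i → (e.symm y : M₀.carrier) ∈ M₀.piece i) →
          ∃ σ : M₀ ≃ₗ⁅K⁆ M₀,
            (∀ i (x : M₀.carrier), x ∈ M₀.piece i → σ x ∈ M₀.piece i) ∧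
            (∀ i (x : M₀.carrier), x ∈ M₀.piece i → σ.symm x ∈ M₀.piece i) ∧
            ∀ x : S, σ (x : M₀.carrier) = (e x : M₀.carrier)) := by
  exact Fr.main_thm K c
end

section
/- Let K be a field. The class of 3-nilpotent graded associative algebras over K does not have the amalgamation property: there exist 3-nilpotent graded associative K-algebras A, B, C and injective graded algebra homomorphisms g0 : B → A and g1 : B → C such that there is no 3-nilpotent graded associative K-algebra D admitting injective graded algebra homomorphisms f0 : A → D and f1 : C → D with f0 ∘ g0 = f1 ∘ g1. -/
universe u

/-- A `3`-nilpotent graded associative algebra over `K`: a non-unital associative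
`K`-algebra together with submodules `piece i` such that the algebra is their
internal direct sum (`piece 0 = ⊥` and `piece n = ⊥` for `n > 3`) and
`piece i * piece j ⊆ piece (i + j)`. -/
structure GradedAssocAlg3 (K : Type u) [Field K] where
  carrier : Type u
  [nonUnitalRing : NonUnitalRing carrier]
  [module : Module K carrier]
  [smulCommClass : SMulCommClass K carrier carrier]
  [isScalarTower : IsScalarTower K carrier carrier]
  piece : ℕ → Submodule K carrier
  isInternal : DirectSum.IsInternal piece
  piece_zero : piece 0 = ⊥
  piece_of_gt : ∀ n, 3 < n → piece n = ⊥
  mul_mem' : ∀ i j (x y : carrier), x ∈ piece i → y ∈ piece j → x * y ∈ piece (i + j)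

attribute [instance] GradedAssocAlg3.nonUnitalRing GradedAssocAlg3.module
  GradedAssocAlg3.smulCommClass GradedAssocAlg3.isScalarTower

instance (K : Type u) [Field K] : CoeSort (GradedAssocAlg3 K) (Type u) :=
  ⟨GradedAssocAlg3.carrier⟩

/-- A (non-unital) algebra homomorphism between graded associative algebras is
graded if it maps the `i`-th component into the `i`-th component for every `i`. -/
def AlgHomIsGraded {K : Type u} [Field K] (A B : GradedAssocAlg3 K)
    (f : A →ₙₐ[K] B) : Prop :=
  ∀ i (x : A), x ∈ A.piece i → f x ∈ B.piece i

/-- underlying vector space with multiplication `u * v = s * u i * v j` at `e k` -/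
def VV {K : Type u} [Field K] {n : ℕ} (_s : K) (_i _j _k : Fin n) : Type u := Fin n → K

section
variable {K : Type u} [Field K] {n : ℕ} (s : K) (i j k : Fin n)

instance : AddCommGroup (VV s i j k) := inferInstanceAs (AddCommGroup (Fin n → K))
instance : Module K (VV s i j k) := inferInstanceAs (Module K (Fin n → K))

/-- the pieces -/
def VVpiece (d : Fin n → ℕ) (m : ℕ) : Submodule K (VV s i j k) where
  carrier := {f | ∀ l, d l ≠ m → f l = 0}
  add_mem' {a b} ha hb l hl := by
    change a l + b l = 0
    rw [ha l hl, hb l hl, add_zero]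
  zero_mem' l _ := rfl
  smul_mem' c a ha l hl := by
    change c * a l = 0
    rw [ha l hl, mul_zero]

theorem VVinternal (d : Fin n → ℕ) : DirectSum.IsInternal (VVpiece s i j k d) := by
  rw [DirectSum.isInternal_submodule_iff_iSupIndep_and_iSup_eq_top]
  constructor
  · rw [iSupIndep_def]
    intro m
    rw [Submodule.disjoint_def]
    intro f hf hf'
    let N : Submodule K (VV s i j k) :=
      { carrier := {f | ∀ l, d l = m → f l = 0}
        add_mem' := by
          intro a b ha hb l hl
          change a l + b l = 0
          rw [ha l hl, hb l hl, add_zero]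
        zero_mem' := fun l _ => rfl
        smul_mem' := by
          intro c a ha l hl
          change c * a l = 0
          rw [ha l hl, mul_zero] }
    have hN : (⨆ (m' : ℕ) (_ : m' ≠ m), VVpiece s i j k d m') ≤ N := by
      refine iSup_le fun m' => iSup_le fun hm => ?_
      intro g hg l hl
      exact hg l (by rw [hl]; exact hm.symm)
    funext l
    by_cases h : d l = m
    · exact hN hf' l h
    · exact hf l h
  · rw [eq_top_iff]
    intro f _
    have h : f = ∑ l, (Pi.single l (f l) : Fin n → K) :=
      (Finset.univ_sum_single (M := fun _ : Fin n => K) f).symm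
    rw [h]
    refine Submodule.sum_mem (M := VV s i j k) _ fun l _ => ?_
    refine Submodule.mem_iSup_of_mem (d l) ?_
    intro l' hl'
    exact Pi.single_eq_of_ne (fun h => hl' (by rw [h])) _

instance : Mul (VV s i j k) := ⟨fun u v => (Pi.single k (s * (u i * v j)) : Fin n → K)⟩

theorem VVmul (u v : VV s i j k) (l : Fin n) :
    (u * v) l = if l = k then s * (u i * v j) else 0 := by
  change (Pi.single k (s * (u i * v j)) : Fin n → K) l = _
  rw [Pi.single_apply]

theorem VVadd (u v : VV s i j k) (l : Fin n) : (u + v) l = u l + v l := rfl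
theorem VVsmul (c : K) (v : VV s i j k) (l : Fin n) : (c • v) l = c * v l := rfl
theorem VVzero (l : Fin n) : (0 : VV s i j k) l = 0 := rfl

/-- the algebra -/
def VValg (d : Fin n → ℕ) (hd : ∀ l, 1 ≤ d l ∧ d l ≤ 3) (hk : s ≠ 0 → d k = d i + d j)
    (hi : i ≠ k) (hj : j ≠ k) : GradedAssocAlg3 K :=
  letI : NonUnitalRing (VV s i j k) :=
    { (inferInstance : AddCommGroup (VV s i j k)), (inferInstance : Mul (VV s i j k)) with
      left_distrib := by
        intro a b c
        funext l
        simp only [VVmul, VVadd]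
        split_ifs <;> ring
      right_distrib := by
        intro a b c
        funext l
        simp only [VVmul, VVadd]
        split_ifs <;> ring
      zero_mul := by
        intro a
        funext l
        simp only [VVmul, VVzero]
        split_ifs <;> ring
      mul_zero := by
        intro a
        funext l
        simp only [VVmul, VVzero]
        split_ifs <;> ring
      mul_assoc := by
        intro a b c
        funext l
        simp only [VVmul, if_neg hi, if_neg hj]
        split_ifs <;> ring }
  { carrier := VV s i j k
    smulCommClass := ⟨by
      intro c a b
      funext l
      simp only [smul_eq_mul, VVmul, VVsmul]
      split_ifs <;> ring⟩
    isScalarTower := ⟨by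
      intro c a b
      funext l
      simp only [smul_eq_mul, VVmul, VVsmul]
      split_ifs <;> ring⟩
    piece := VVpiece s i j k d
    isInternal := VVinternal s i j k d
    piece_zero := by
      rw [eq_bot_iff]
      intro f hf
      rw [Submodule.mem_bot]
      funext l
      exact hf l (by have := hd l; omega)
    piece_of_gt := by
      intro m hm
      rw [eq_bot_iff]
      intro f hf
      rw [Submodule.mem_bot]
      funext l
      exact hf l (by have := hd l; omega)
    mul_mem' := by
      intro p q x y hx hy l hl
      rw [VVmul]
      split_ifs with h
      · by_cases hs : s = 0
        · rw [hs, zero_mul]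
        by_cases h1 : d i = p
        · by_cases h2 : d j = q
          · exact absurd (by rw [h, hk hs, h1, h2]) hl
          · rw [hy j h2]; ring
        · rw [hx i h1]; ring
      · rfl }

end

/-- the class of `3`-nilpotent graded associative algebras over a
field `K` does not have the amalgamation property. -/
theorem gradedAssocAlg3_no_amalgamation (K : Type u) [Field K] :
    ∃ (A B C : GradedAssocAlg3 K) (g0 : B →ₙₐ[K] A) (g1 : B →ₙₐ[K] C),
      Function.Injective g0 ∧ AlgHomIsGraded B A g0 ∧
      Function.Injective g1 ∧ AlgHomIsGraded B C g1 ∧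
      ¬ ∃ (D : GradedAssocAlg3 K) (f0 : A →ₙₐ[K] D) (f1 : C →ₙₐ[K] D),
          Function.Injective f0 ∧ AlgHomIsGraded A D f0 ∧
          Function.Injective f1 ∧ AlgHomIsGraded C D f1 ∧
          f0.comp g0 = f1.comp g1 := by
  -- `B = ⟨x, p⟩`, `A = ⟨x, p, a⟩` with `a x = p`, `C = ⟨x, p, c, r⟩` with `p c = r`
  let B : GradedAssocAlg3 K := VValg (n := 2) (0 : K) 0 0 1 ![1, 2]
    (by decide) (fun h => absurd rfl h) (by decide) (by decide)
  let A : GradedAssocAlg3 K := VValg (n := 3) (1 : K) 2 0 1 ![1, 2, 1]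
    (by decide) (fun _ => rfl) (by decide) (by decide)
  let C : GradedAssocAlg3 K := VValg (n := 4) (1 : K) 1 2 3 ![1, 2, 1, 3]
    (by decide) (fun _ => rfl) (by decide) (by decide)
  let g0 : B →ₙₐ[K] A :=
    { toFun := fun u => (![u 0, u 1, 0] : Fin 3 → K)
      map_smul' := by
        intro c u; funext l
        change _ = c * _
        fin_cases l
        · rfl
        · rfl
        · exact (mul_zero c).symm
      map_zero' := by funext l; fin_cases l <;> rfl
      map_add' := by
        intro u v; funext l
        change _ = (_ : K) + _
        fin_cases l
        · rfl
        · rfl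
        · exact (add_zero (0 : K)).symm
      map_mul' := by
        intro u v; funext l
        refine Eq.trans ?_ (VVmul (1 : K) (2 : Fin 3) 0 1 _ _ l).symm
        have h0 : (u * v) 0 = 0 := (VVmul (0 : K) (0 : Fin 2) 0 1 u v 0).trans (by simp)
        have h1 : (u * v) 1 = 0 := (VVmul (0 : K) (0 : Fin 2) 0 1 u v 1).trans (by simp)
        rw [h0, h1]
        fin_cases l <;> simp }
  let g1 : B →ₙₐ[K] C :=
    { toFun := fun u => (![u 0, u 1, 0, 0] : Fin 4 → K)
      map_smul' := by
        intro c u; funext l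
        change _ = c * _
        fin_cases l
        · rfl
        · rfl
        · exact (mul_zero c).symm
        · exact (mul_zero c).symm
      map_zero' := by funext l; fin_cases l <;> rfl
      map_add' := by
        intro u v; funext l
        change _ = (_ : K) + _
        fin_cases l
        · rfl
        · rfl
        · exact (add_zero (0 : K)).symm
        · exact (add_zero (0 : K)).symm
      map_mul' := by
        intro u v; funext l
        refine Eq.trans ?_ (VVmul (1 : K) (1 : Fin 4) 2 3 _ _ l).symm
        have h0 : (u * v) 0 = 0 := (VVmul (0 : K) (0 : Fin 2) 0 1 u v 0).trans (by simp)
        have h1 : (u * v) 1 = 0 := (VVmul (0 : K) (0 : Fin 2) 0 1 u v 1).trans (by simp)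
        rw [h0, h1]
        fin_cases l <;> simp }
  refine ⟨A, B, C, g0, g1, ?_, ?_, ?_, ?_, ?_⟩
  · intro u v h
    funext l
    fin_cases l
    · exact congrFun h (0 : Fin 3)
    · exact congrFun h (1 : Fin 3)
  · intro m u hu l hl
    fin_cases l
    · exact hu (0 : Fin 2) hl
    · exact hu (1 : Fin 2) hl
    · rfl
  · intro u v h
    funext l
    fin_cases l
    · exact congrFun h (0 : Fin 4)
    · exact congrFun h (1 : Fin 4)
  · intro m u hu l hl
    fin_cases l
    · exact hu (0 : Fin 2) hl
    · exact hu (1 : Fin 2) hl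
    · rfl
    · rfl
  · rintro ⟨D, f0, f1, -, -, hf1, -, hcomp⟩
    let x : B := (![1, 0] : Fin 2 → K)
    let p : B := (![0, 1] : Fin 2 → K)
    let a : A := (![0, 0, 1] : Fin 3 → K)
    let c : C := (![0, 0, 1, 0] : Fin 4 → K)
    have hax : a * g0 x = g0 p := by
      funext l
      refine (VVmul (1 : K) (2 : Fin 3) 0 1 _ _ l).trans ?_
      fin_cases l <;> (simp [a, x, p, g0]; rfl)
    have hxc : g1 x * c = 0 := by
      funext l
      refine (VVmul (1 : K) (1 : Fin 4) 2 3 _ _ l).trans ?_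
      refine Eq.trans ?_ (VVzero (1 : K) (1 : Fin 4) 2 3 l).symm
      fin_cases l <;> simp [x, c, g1]
      rfl
    have hpc : g1 p * c ≠ 0 := by
      intro h
      have h3 := congrFun h (3 : Fin 4)
      have h4 := (VVmul (1 : K) (1 : Fin 4) 2 3 (g1 p) c 3).symm.trans h3
      have h5 := h4.trans (VVzero (1 : K) (1 : Fin 4) 2 3 3)
      simp [p, c, g1] at h5
      exact one_ne_zero (α := K) h5
    have hx : f0 (g0 x) = f1 (g1 x) := DFunLike.congr_fun hcomp x
    have hp : f0 (g0 p) = f1 (g1 p) := DFunLike.congr_fun hcomp p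
    apply hpc
    apply hf1
    rw [map_mul, map_zero, ← hp, ← hax, map_mul, hx, mul_assoc, ← map_mul, hxc, map_zero, mul_zero]
end

section
/- Let L be a countable first-order language and M_0 a countable ultrahomogeneous L-structure such that for all finitely generated substructures A, C of M_0 with a common substructure B, a free amalgam of A and C over B with respect to age(M_0) exists in age(M_0). Then for all finite tuples a, b, c of M_0 there is an automorphism σ of M_0 fixing every entry of b such that ⟨σ(a) b c⟩ is the free amalgam of ⟨σ(a) b⟩ and ⟨b c⟩ over ⟨b⟩ with respect to age(M_0), where ⟨x⟩ denotes the substructure of M_0 generated by the entries of the tuples listed. (This is the Existence property of the free-amalgam independence relation, since σ(a) realizes the same type as a over b.) -/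
open FirstOrder FirstOrder.Language

universe u v w

/-- `D` is the free amalgam of `A` and `C` over `B` with respect to the class `J`,
all taken as substructures of an ambient `L`-structure `N`. -/
def IsFreeAmalgamIn (L : FirstOrder.Language.{u, v})
    (J : Set (CategoryTheory.Bundled.{w} L.Structure))
    {N : Type w} [L.Structure N] (A B C D : L.Substructure N) : Prop :=
  A ≤ D ∧ C ≤ D ∧ B = A ⊓ C ∧ A ⊔ C = D ∧
    ∀ E ∈ J, ∀ (f : A →[L] E) (g : C →[L] E),
      (∀ (x : N) (hA : x ∈ A) (hC : x ∈ C), f ⟨x, hA⟩ = g ⟨x, hC⟩) →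
      ∃ h : D →[L] E,
        (∀ (x : N) (hx : x ∈ A) (hx' : x ∈ D), h ⟨x, hx'⟩ = f ⟨x, hx⟩) ∧
        (∀ (x : N) (hx : x ∈ C) (hx' : x ∈ D), h ⟨x, hx'⟩ = g ⟨x, hx⟩)

/-- For every pair of finitely generated substructures `A`, `C` of `M` with a common
substructure `B`, a free amalgam of `A` and `C` over `B` with respect to `age(M)`
exists in `age(M)`. -/
def HasFreeAmalgamsInAge (L : FirstOrder.Language.{u, v}) (M : Type w) [L.Structure M] : Prop :=
  ∀ A C B : L.Substructure M, A.FG → C.FG → ∀ (hBA : B ≤ A) (hBC : B ≤ C),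
    ∃ D ∈ L.age M, ∃ (f0 : A ↪[L] D) (f1 : C ↪[L] D),
      f0.comp (Substructure.inclusion hBA) = f1.comp (Substructure.inclusion hBC) ∧
      IsFreeAmalgamIn L (L.age M) f0.toHom.range
        ((f0.comp (Substructure.inclusion hBA)).toHom.range) f1.toHom.range ⊤

theorem IsFreeAmalgamIn.map_emb {L : FirstOrder.Language.{u, v}}
    {J : Set (CategoryTheory.Bundled.{w} L.Structure)}
    {N P : Type w} [L.Structure N] [L.Structure P] {A B C D : L.Substructure N}
    (j : N ↪[L] P) (H : IsFreeAmalgamIn L J A B C D) :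
    IsFreeAmalgamIn L J (A.map j.toHom) (B.map j.toHom) (C.map j.toHom) (D.map j.toHom) := by
  obtain ⟨h1, h2, h3, h4, h5⟩ := H
  have hj : ∀ {S : L.Substructure N} {x : N}, j x ∈ S.map j.toHom ↔ x ∈ S := by
    intro S x
    rw [Substructure.mem_map]
    constructor
    · rintro ⟨y, hy, e⟩
      have : y = x := j.injective e
      exact this ▸ hy
    · intro h
      exact ⟨x, h, rfl⟩
  refine ⟨Substructure.monotone_map h1, Substructure.monotone_map h2, ?_, ?_, ?_⟩
  · ext y
    rw [Substructure.mem_inf]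
    constructor
    · rintro ⟨x, hx, rfl⟩
      rw [h3] at hx
      exact ⟨⟨x, hx.1, rfl⟩, ⟨x, hx.2, rfl⟩⟩
    · rintro ⟨⟨x, hx, rfl⟩, hy⟩
      have : x ∈ C := hj.1 hy
      refine ⟨x, ?_, rfl⟩
      rw [h3]
      exact ⟨hx, this⟩
  · rw [← Substructure.map_sup, h4]
  · intro E hE f g hfg
    obtain ⟨h, hf, hg⟩ := h5 E hE (f.comp (j.substructureEquivMap A).toHom)
      (g.comp (j.substructureEquivMap C).toHom) (fun x hA hC => hfg (j x) (hj.2 hA) (hj.2 hC))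
    have key : ∀ (x : N) (hx : x ∈ D) (hx' : j x ∈ D.map j.toHom),
        (j.substructureEquivMap D).symm ⟨j x, hx'⟩ = ⟨x, hx⟩ := by
      intro x hx hx'
      apply (j.substructureEquivMap D).injective
      rw [FirstOrder.Language.Equiv.apply_symm_apply]
      rfl
    refine ⟨h.comp (j.substructureEquivMap D).symm.toHom, ?_, ?_⟩
    · rintro _ ⟨x, hx, rfl⟩ hx'
      have := key x (h1 hx) hx'
      exact (congrArg h this).trans (hf x hx (h1 hx))
    · rintro _ ⟨x, hx, rfl⟩ hx'
      have := key x (h2 hx) hx'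
      exact (congrArg h this).trans (hg x hx (h2 hx))

/-- Existence: if `M₀` is a countable ultrahomogeneous structure over
a countable language whose age has free amalgamation, then for all finite tuples
`a, b, c` there is an automorphism `σ` of `M₀` fixing `b` pointwise such that
`⟨σ(a) b c⟩` is the free amalgam of `⟨σ(a) b⟩` and `⟨b c⟩` over `⟨b⟩` with respect
to `age(M₀)`. -/
theorem freeAmalgam_existence (L : FirstOrder.Language.{u, v})
    [Countable L.Symbols] (M₀ : Type w) [L.Structure M₀] [Countable M₀]
    (hHom : L.IsUltrahomogeneous M₀)
    (hFA : HasFreeAmalgamsInAge L M₀) :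
    ∀ (n m k : ℕ) (a : Fin n → M₀) (b : Fin m → M₀) (c : Fin k → M₀),
      ∃ σ : M₀ ≃[L] M₀, (∀ i, σ (b i) = b i) ∧
        IsFreeAmalgamIn L (L.age M₀)
          (Substructure.closure L (Set.range (σ ∘ a) ∪ Set.range b))
          (Substructure.closure L (Set.range b))
          (Substructure.closure L (Set.range b ∪ Set.range c))
          (Substructure.closure L (Set.range (σ ∘ a) ∪ Set.range b ∪ Set.range c)) := by
  intro n m k a b c
  let A := Substructure.closure L (Set.range a ∪ Set.range b)
  let B := Substructure.closure L (Set.range b)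
  let C := Substructure.closure L (Set.range b ∪ Set.range c)
  have hA : A.FG := Substructure.fg_closure ((Set.finite_range a).union (Set.finite_range b))
  have hC : C.FG := Substructure.fg_closure ((Set.finite_range b).union (Set.finite_range c))
  have hBA : B ≤ A := Substructure.closure_mono Set.subset_union_right
  have hBC : B ≤ C := Substructure.closure_mono Set.subset_union_left
  obtain ⟨D, hD, f0, f1, hcomp, hfree⟩ := hFA A C B hA hC hBA hBC
  obtain ⟨e⟩ := hD.2
  obtain ⟨τ, hτ⟩ := hHom C hC (e.comp f1)
  let j : D ↪[L] M₀ := τ.symm.toEmbedding.comp e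
  have hj1 : ∀ x : C, j (f1 x) = x := by
    intro x
    have h : e (f1 x) = τ x := DFunLike.congr_fun hτ x
    change τ.symm (e (f1 x)) = x
    rw [h, FirstOrder.Language.Equiv.symm_apply_apply]
  obtain ⟨σ, hσ⟩ := hHom A hA (j.comp f0)
  have hj0 : ∀ x : A, j (f0 x) = σ x := fun x => DFunLike.congr_fun hσ x
  have hjB : ∀ (x : M₀) (hx : x ∈ B), f0 ⟨x, hBA hx⟩ = f1 ⟨x, hBC hx⟩ := fun x hx =>
    DFunLike.congr_fun hcomp ⟨x, hx⟩
  have hσB : ∀ x ∈ B, σ x = x := by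
    intro x hx
    rw [← hj0 ⟨x, hBA hx⟩, hjB x hx, hj1]
  have hσb : ∀ i, σ (b i) = b i := fun i =>
    hσB _ (Substructure.subset_closure (Set.mem_range_self i))
  refine ⟨σ, hσb, ?_⟩
  have H := hfree.map_emb j
  have e1 : (f0.toHom.range).map j.toHom
      = Substructure.closure L (Set.range (σ ∘ a) ∪ Set.range b) := by
    have : Set.range (σ ∘ a) ∪ Set.range b = σ.toHom '' (Set.range a ∪ Set.range b) := by
      rw [Set.image_union, ← Set.range_comp, ← Set.range_comp]
      congr 2
      funext i
      exact (hσb i).symm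
    rw [this, ← Substructure.map_closure]
    ext y
    constructor
    · rintro ⟨_, ⟨x, rfl⟩, rfl⟩
      exact ⟨x, x.2, (hj0 x).symm⟩
    · rintro ⟨x, hx, rfl⟩
      exact ⟨_, ⟨⟨x, hx⟩, rfl⟩, hj0 ⟨x, hx⟩⟩
  have e2 : ((f0.comp (Substructure.inclusion hBA)).toHom.range).map j.toHom = B := by
    ext y
    constructor
    · rintro ⟨_, ⟨x, rfl⟩, rfl⟩
      have : j (f0 ⟨x, hBA x.2⟩) = x := (hj0 _).trans (hσB x x.2)
      exact this.symm ▸ x.2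
    · intro hy
      exact ⟨_, ⟨⟨y, hy⟩, rfl⟩, (hj0 ⟨y, hBA hy⟩).trans (hσB y hy)⟩
  have e3 : (f1.toHom.range).map j.toHom = C := by
    ext y
    constructor
    · rintro ⟨_, ⟨x, rfl⟩, rfl⟩
      exact (hj1 x).symm ▸ x.2
    · intro hy
      exact ⟨_, ⟨⟨y, hy⟩, rfl⟩, hj1 ⟨y, hy⟩⟩
  have e4 : (⊤ : L.Substructure D).map j.toHom
      = Substructure.closure L (Set.range (σ ∘ a) ∪ Set.range b ∪ Set.range c) := by
    rw [← H.2.2.2.1, e1, e3, ← Substructure.closure_union]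
    congr 1
    ext y
    simp only [Set.mem_union]
    tauto
  rw [e1, e2, e3, e4] at H
  exact H
end

section
/- Let L be a countable first-order language and M_0 a countable ultrahomogeneous L-structure. Let a, a' be finite tuples and b, c finite tuples of M_0, and suppose: ⟨a b c⟩ is the free amalgam of ⟨a b⟩ and ⟨b c⟩ over ⟨b⟩ with respect to age(M_0); ⟨a' b c⟩ is the free amalgam of ⟨a' b⟩ and ⟨b c⟩ over ⟨b⟩ with respect to age(M_0); and there is an automorphism of M_0 fixing every entry of b and mapping a to a'. Then there is an automorphism of M_0 fixing every entry of b and every entry of c and mapping a to a'. (This is the Stationarity property of the free-amalgam independence relation; here ⟨x⟩ denotes the substructure of M_0 generated by the entries of the tuples listed.) -/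
open FirstOrder FirstOrder.Language

universe u v w

theorem freeAmalgam_hom_aux (L : FirstOrder.Language.{u, v})
    (M₀ : Type w) [L.Structure M₀]
    {n m k : ℕ} (a a' : Fin n → M₀) (b : Fin m → M₀) (c : Fin k → M₀)
    (h1 : IsFreeAmalgamIn L (L.age M₀)
      (Substructure.closure L (Set.range a ∪ Set.range b))
      (Substructure.closure L (Set.range b))
      (Substructure.closure L (Set.range b ∪ Set.range c))
      (Substructure.closure L (Set.range a ∪ Set.range b ∪ Set.range c)))
    (σ : M₀ ≃[L] M₀) (hσb : ∀ i, σ (b i) = b i) (hσa : ∀ i, σ (a i) = a' i) :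
    ∃ h : Substructure.closure L (Set.range a ∪ Set.range b ∪ Set.range c) →[L]
        Substructure.closure L (Set.range a' ∪ Set.range b ∪ Set.range c),
      (∀ i hx, (h ⟨a i, hx⟩ : M₀) = a' i) ∧ (∀ i hx, (h ⟨b i, hx⟩ : M₀) = b i) ∧
      (∀ i hx, (h ⟨c i, hx⟩ : M₀) = c i) := by
  obtain ⟨-, -, hB, -, H⟩ := h1
  have hfg : (Substructure.closure L (Set.range a' ∪ Set.range b ∪ Set.range c)).FG :=
    Substructure.fg_closure (((Set.finite_range _).union (Set.finite_range _)).union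
      (Set.finite_range _))
  have hAD : ∀ x : Substructure.closure L (Set.range a ∪ Set.range b),
      σ x ∈ Substructure.closure L (Set.range a' ∪ Set.range b ∪ Set.range c) := by
    have : Substructure.closure L (Set.range a ∪ Set.range b) ≤
        (Substructure.closure L (Set.range a' ∪ Set.range b ∪ Set.range c)).comap
          σ.toHom := by
      rw [Substructure.closure_le]
      rintro _ (⟨i, rfl⟩ | ⟨i, rfl⟩)
      · show σ (a i) ∈ Substructure.closure L (Set.range a' ∪ Set.range b ∪ Set.range c)
        rw [hσa]; exact Substructure.subset_closure (Or.inl (Or.inl ⟨i, rfl⟩))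
      · show σ (b i) ∈ Substructure.closure L (Set.range a' ∪ Set.range b ∪ Set.range c)
        rw [hσb]; exact Substructure.subset_closure (Or.inl (Or.inr ⟨i, rfl⟩))
    exact fun x => this x.2
  have hCD : Substructure.closure L (Set.range b ∪ Set.range c) ≤
      Substructure.closure L (Set.range a' ∪ Set.range b ∪ Set.range c) := by
    apply (Substructure.closure L).monotone
    rintro x (h | h)
    · exact Or.inl (Or.inr h)
    · exact Or.inr h
  have hfix : Set.EqOn σ.toHom (Hom.id L M₀) (Substructure.closure L (Set.range b)) := by
    apply Hom.eqOn_closure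
    rintro _ ⟨i, rfl⟩
    exact hσb i
  obtain ⟨h, hA, hC⟩ := H _ (age.fg_substructure hfg)
    (Hom.codRestrict _ (σ.toHom.comp (Substructure.subtype _).toHom) hAD)
    (Substructure.inclusion hCD).toHom (by
      intro x hxA hxC
      have hx : x ∈ Substructure.closure L (Set.range b) := by rw [hB]; exact ⟨hxA, hxC⟩
      exact Subtype.ext (hfix hx))
  refine ⟨h, fun i hx => ?_, fun i hx => ?_, fun i hx => ?_⟩
  · rw [hA (a i) (Substructure.subset_closure (Or.inl ⟨i, rfl⟩)) hx]
    exact hσa i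
  · rw [hA (b i) (Substructure.subset_closure (Or.inr ⟨i, rfl⟩)) hx]
    exact hσb i
  · rw [hC (c i) (Substructure.subset_closure (Or.inr ⟨i, rfl⟩)) hx]
    rfl

theorem hom_comp_aux (L : FirstOrder.Language.{u, v})
    (M₀ : Type w) [L.Structure M₀] (s : Set M₀)
    (q : Substructure.closure L s →[L] Substructure.closure L s)
    (H : ∀ x ∈ s, ∀ hx, (q ⟨x, hx⟩ : M₀) = x) (x : Substructure.closure L s) :
    q x = x := by
  have : Substructure.closure L s ≤
      (q.eqLocus (Hom.id L _)).map (Substructure.subtype _).toHom := by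
    rw [Substructure.closure_le]
    intro x hx
    exact ⟨⟨x, Substructure.subset_closure hx⟩, Subtype.ext (H x hx _), rfl⟩
  obtain ⟨y, hy, hyx⟩ := this x.2
  have : y = x := Subtype.ext hyx
  subst this
  exact hy

/-- Stationarity: let `M₀` be a countable ultrahomogeneous structure
over a countable language.  If `⟨a b c⟩` and `⟨a' b c⟩` are the free amalgams of
`⟨a b⟩` resp. `⟨a' b⟩` and `⟨b c⟩` over `⟨b⟩` with respect to `age(M₀)`, and some
automorphism of `M₀` fixes `b` pointwise and maps `a` to `a'`, then some
automorphism of `M₀` fixes `b` and `c` pointwise and maps `a` to `a'`. -/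
theorem freeAmalgam_stationarity (L : FirstOrder.Language.{u, v})
    [Countable L.Symbols] (M₀ : Type w) [L.Structure M₀] [Countable M₀]
    (hHom : L.IsUltrahomogeneous M₀)
    {n m k : ℕ} (a a' : Fin n → M₀) (b : Fin m → M₀) (c : Fin k → M₀)
    (h1 : IsFreeAmalgamIn L (L.age M₀)
      (Substructure.closure L (Set.range a ∪ Set.range b))
      (Substructure.closure L (Set.range b))
      (Substructure.closure L (Set.range b ∪ Set.range c))
      (Substructure.closure L (Set.range a ∪ Set.range b ∪ Set.range c)))
    (h2 : IsFreeAmalgamIn L (L.age M₀)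
      (Substructure.closure L (Set.range a' ∪ Set.range b))
      (Substructure.closure L (Set.range b))
      (Substructure.closure L (Set.range b ∪ Set.range c))
      (Substructure.closure L (Set.range a' ∪ Set.range b ∪ Set.range c)))
    (σ : M₀ ≃[L] M₀) (hσb : ∀ i, σ (b i) = b i) (hσa : ∀ i, σ (a i) = a' i) :
    ∃ τ : M₀ ≃[L] M₀, (∀ i, τ (b i) = b i) ∧ (∀ i, τ (c i) = c i) ∧
      ∀ i, τ (a i) = a' i := by
  obtain ⟨h, ha, hb, hc⟩ := freeAmalgam_hom_aux L M₀ a a' b c h1 σ hσb hσa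
  obtain ⟨h', ha', hb', hc'⟩ := freeAmalgam_hom_aux L M₀ a' a b c h2 σ.symm
    (fun i => by rw [← hσb i, FirstOrder.Language.Equiv.symm_apply_apply, hσb])
    (fun i => by rw [← hσa i, FirstOrder.Language.Equiv.symm_apply_apply])
  have hid : ∀ x, h' (h x) = x := by
    refine hom_comp_aux L M₀ _ (h'.comp h) ?_
    rintro _ ((⟨i, rfl⟩ | ⟨i, rfl⟩) | ⟨i, rfl⟩) hx
    · have e : h ⟨a i, hx⟩ = ⟨a' i, Substructure.subset_closure (Or.inl (Or.inl ⟨i, rfl⟩))⟩ :=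
        Subtype.ext (ha i hx)
      rw [Hom.comp_apply, e, ha']
    · have e : h ⟨b i, hx⟩ = ⟨b i, Substructure.subset_closure (Or.inl (Or.inr ⟨i, rfl⟩))⟩ :=
        Subtype.ext (hb i hx)
      rw [Hom.comp_apply, e, hb']
    · have e : h ⟨c i, hx⟩ = ⟨c i, Substructure.subset_closure (Or.inr ⟨i, rfl⟩)⟩ :=
        Subtype.ext (hc i hx)
      rw [Hom.comp_apply, e, hc']
  let F : Substructure.closure L (Set.range a ∪ Set.range b ∪ Set.range c) ↪[L]
      Substructure.closure L (Set.range a' ∪ Set.range b ∪ Set.range c) :=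
    { toFun := h
      inj' := Function.LeftInverse.injective hid
      map_fun' := fun f x => h.map_fun f x
      map_rel' := fun R x => ⟨fun hr => by
        have := h'.map_rel R _ hr
        have e : h' ∘ h ∘ x = x := funext fun i => hid (x i)
        rw [← e]; exact this, fun hr => h.map_rel R x hr⟩ }
  have hfg : (Substructure.closure L (Set.range a ∪ Set.range b ∪ Set.range c)).FG :=
    Substructure.fg_closure (((Set.finite_range _).union (Set.finite_range _)).union
      (Set.finite_range _))
  obtain ⟨τ, hτ⟩ := hHom _ hfg ((Substructure.subtype _).comp F)
  have key : ∀ x, (h x : M₀) = τ x := fun x => DFunLike.congr_fun hτ x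
  refine ⟨τ, fun i => ?_, fun i => ?_, fun i => ?_⟩
  · exact (key ⟨b i, Substructure.subset_closure (Or.inl (Or.inr ⟨i, rfl⟩))⟩).symm.trans (hb i _)
  · exact (key ⟨c i, Substructure.subset_closure (Or.inr ⟨i, rfl⟩)⟩).symm.trans (hc i _)
  · exact (key ⟨a i, Substructure.subset_closure (Or.inl (Or.inl ⟨i, rfl⟩))⟩).symm.trans (ha i _)
end
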